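/- arXiv:0812.2366 — 2 statements merged into one kernel-verified Lean document; each statement's English description precedes it below -/
import Mathlib

section
/- Let L_n^{d,alpha} be a line hypergraph with d > 2*alpha. Then the top graded Betti numbers of R/I(L_n^{d,alpha}) satisfy: beta_{n,j}(R/I(L_n^{d,alpha})) = 1 if j = n(d - alpha) + alpha, and beta_{n,j}(R/I(L_n^{d,alpha})) = 0 for every other j. -/
open MvPolynomial

/-- A *minimal graded free resolution* of `R ⧸ I`, where `R = k[x_v : v ∈ V]` is the
polynomial ring with its standard grading.  The `i`-th free module is
`⨁_j R(-j)^{β i j}`, encoded as finitely supported functions on `Σ j, Fin (β i j)`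
(the basis element `⟨j, t⟩` having degree `j`).  The graded Betti number
`β_{i,j}(R ⧸ I) = dim_k Tor_i^R(R ⧸ I, k)_j` equals `β i j` for any such resolution. -/
structure MinimalGradedFreeResolution (k V : Type) [Field k] [Fintype V] [DecidableEq V]
    (I : Ideal (MvPolynomial V k)) where
  /-- the ranks: `β i j` copies of `R(-j)` in homological degree `i` -/
  β : ℕ → ℕ → ℕ
  /-- the `0`-th free module is a single copy of `R` generated in degree `0` -/
  β_zero : ∀ j, β 0 j = if j = 0 then 1 else 0
  /-- the differentials -/
  d : ∀ i : ℕ,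
    ((Σ j : ℕ, Fin (β (i + 1) j)) →₀ MvPolynomial V k) →ₗ[MvPolynomial V k]
      ((Σ j : ℕ, Fin (β i j)) →₀ MvPolynomial V k)
  /-- the augmentation onto `R ⧸ I` -/
  aug : ((Σ j : ℕ, Fin (β 0 j)) →₀ MvPolynomial V k) →ₗ[MvPolynomial V k]
      (MvPolynomial V k ⧸ I)
  aug_surjective : Function.Surjective aug
  /-- exactness at homological degree `0` -/
  exact_zero : LinearMap.ker aug = LinearMap.range (d 0)
  /-- exactness at homological degree `i + 1` -/
  exact_succ : ∀ i, LinearMap.ker (d i) = LinearMap.range (d (i + 1))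
  /-- minimality: the image of each differential lies in `m · F`, where `m = (x_v : v ∈ V)` -/
  minimal : ∀ i x p, constantCoeff ((d i x) p) = 0
  /-- the differentials are graded: the image of a degree-`j` basis vector is homogeneous
  of degree `j` -/
  graded : ∀ (i j : ℕ) (t : Fin (β (i + 1) j)) (p : Σ j' : ℕ, Fin (β i j')),
      ((d i (Finsupp.single ⟨j, t⟩ 1)) p).IsHomogeneous (j - p.1) ∧
        (p.1 ≤ j ∨ (d i (Finsupp.single ⟨j, t⟩ 1)) p = 0)

/-- The edge ideal `I(H)` of a hypergraph with edges `E 0, …, E (n-1)`: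
the ideal generated by the squarefree monomials `x^{E i} = ∏_{v ∈ E i} x_v`. -/
noncomputable def edgeIdeal (k : Type) {V : Type} [Field k] [Fintype V] [DecidableEq V]
    {n : ℕ} (E : Fin n → Finset V) : Ideal (MvPolynomial V k) :=
  Ideal.span (Set.range fun i => ∏ v ∈ E i, (X v : MvPolynomial V k))

/-- `E 0, …, E (n-1)` are the edges of a line hypergraph `L_n^{d,α}`, whose vertex set is
all of `V` (the union of the edges): each edge has `d` vertices, two distinct edges
intersect exactly when they are consecutive, and consecutive edges meet in `α` vertices. -/
structure IsLineHypergraph {V : Type} [DecidableEq V] (n d α : ℕ) (E : ℕ → Finset V) :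
    Prop where
  card_eq : ∀ i < n, (E i).card = d
  inter_nonempty_iff : ∀ i < n, ∀ j < n, i ≠ j →
    ((E i ∩ E j).Nonempty ↔ (j = i + 1 ∨ i = j + 1))
  inter_card : ∀ i, i + 1 < n → (E i ∩ E (i + 1)).card = α
  cover : ∀ v : V, ∃ i < n, v ∈ E i


variable {k V : Type} [Field k]

/-- all monomials `x^s e_p` occurring in `x` have degree satisfying `P` -/
def DegP (k V : Type) [Field k] {ι : Type} (deg : ι → ℕ) (P : ℕ → Prop) (x : ι →₀ MvPolynomial V k) : Prop :=
  ∀ p s, coeff s (x p) ≠ 0 → P (s.degree + deg p)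

def Gr {ι κ : Type} (di : ι → ℕ) (dk : κ → ℕ)
    (f : (ι →₀ MvPolynomial V k) →ₗ[MvPolynomial V k] (κ →₀ MvPolynomial V k)) : Prop :=
  ∀ a, DegP k V dk (fun j => j = di a) (f (Finsupp.single a 1))

theorem map_eq_sum {ι κ : Type} 
    (f : (ι →₀ MvPolynomial V k) →ₗ[MvPolynomial V k] (κ →₀ MvPolynomial V k))
    (x : ι →₀ MvPolynomial V k) (p : κ) :
    f x p = ∑ a ∈ x.support, x a * f (Finsupp.single a 1) p := by
  conv_lhs => rw [← Finsupp.sum_single x]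
  rw [Finsupp.sum, map_sum, Finsupp.finsetSum_apply]
  refine Finset.sum_congr rfl fun a _ => ?_
  have : Finsupp.single a (x a) = x a • Finsupp.single a (1 : MvPolynomial V k) := by simp
  rw [this, map_smul, Finsupp.smul_apply, smul_eq_mul]

theorem Gr.degP {ι κ : Type} {di : ι → ℕ} {dk : κ → ℕ}
    {f : (ι →₀ MvPolynomial V k) →ₗ[MvPolynomial V k] (κ →₀ MvPolynomial V k)}
    (hf : Gr di dk f) {P : ℕ → Prop} {x : ι →₀ MvPolynomial V k} (hx : DegP k V di P x) :
    DegP k V dk P (f x) := by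
  classical
  intro p s hs
  rw [map_eq_sum, coeff_sum] at hs
  obtain ⟨a, -, ha⟩ := Finset.exists_ne_zero_of_sum_ne_zero hs
  rw [coeff_mul] at ha
  obtain ⟨⟨u, v⟩, huv, h⟩ := Finset.exists_ne_zero_of_sum_ne_zero ha
  rw [Finset.HasAntidiagonal.mem_antidiagonal] at huv
  simp only at huv h
  have h1 := hx a u (left_ne_zero_of_mul h)
  have h2 := hf a p v (right_ne_zero_of_mul h)
  simp only at h2
  rw [← h2] at h1
  rw [← huv, map_add, add_assoc]
  exact h1

theorem Gr.comp {ι κ μ : Type} {di : ι → ℕ} {dk : κ → ℕ} {dm : μ → ℕ}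
    {f : (ι →₀ MvPolynomial V k) →ₗ[MvPolynomial V k] (κ →₀ MvPolynomial V k)}
    {g : (κ →₀ MvPolynomial V k) →ₗ[MvPolynomial V k] (μ →₀ MvPolynomial V k)}
    (hg : Gr dk dm g) (hf : Gr di dk f) : Gr di dm (g ∘ₗ f) :=
  fun a => hg.degP (hf a)

theorem DegP.add {ι : Type} {deg : ι → ℕ} {P : ℕ → Prop} {x y : ι →₀ MvPolynomial V k}
    (hx : DegP k V deg P x) (hy : DegP k V deg P y) : DegP k V deg P (x + y) := by
  intro p s hs
  by_cases h : coeff s (x p) = 0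
  · refine hy p s fun h' => hs ?_
    rw [Finsupp.add_apply, coeff_add, h, h', add_zero]
  · exact hx p s h

theorem DegP.neg {ι : Type} {deg : ι → ℕ} {P : ℕ → Prop} {x : ι →₀ MvPolynomial V k}
    (hx : DegP k V deg P x) : DegP k V deg P (-x) := by
  intro p s hs
  refine hx p s fun h => hs ?_
  rw [Finsupp.neg_apply, coeff_neg, h, neg_zero]

theorem exists_part {ι : Type} (deg : ι → ℕ) (j : ℕ) (x : ι →₀ MvPolynomial V k) :
    ∃ y, DegP k V deg (fun i => i = j) y ∧ DegP k V deg (fun i => i ≠ j) (x - y) := by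
  classical
  refine ⟨Finsupp.onFinset x.support
    (fun p => if deg p ≤ j then homogeneousComponent (j - deg p) (x p) else 0) ?_, ?_, ?_⟩
  · intro a ha
    rw [Finsupp.mem_support_iff]
    intro h
    simp [h] at ha
  · intro p s hs
    rw [Finsupp.onFinset_apply] at hs
    split_ifs at hs with h
    · rw [coeff_homogeneousComponent] at hs
      split_ifs at hs with h'
      · show _ = _
        omega
      · exact absurd rfl hs
    · simp at hs
  · intro p s hs h
    apply hs
    rw [Finsupp.sub_apply, Finsupp.onFinset_apply, if_pos (by omega), coeff_sub,
      coeff_homogeneousComponent, if_pos (by omega), sub_self]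

theorem exists_hom_preimage {κ μ : Type} {dk : κ → ℕ} {dm : μ → ℕ}
    {d : (κ →₀ MvPolynomial V k) →ₗ[MvPolynomial V k] (μ →₀ MvPolynomial V k)}
    (hd : Gr dk dm d) (j : ℕ) (y : μ →₀ MvPolynomial V k) (hy : DegP k V dm (fun i => i = j) y)
    (hr : y ∈ LinearMap.range d) : ∃ x, DegP k V dk (fun i => i = j) x ∧ d x = y := by
  obtain ⟨x, rfl⟩ := hr
  obtain ⟨x', h1, h2⟩ := exists_part dk j x
  refine ⟨x', h1, ?_⟩
  have h3 := hd.degP h2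
  have h4 := hy.add (hd.degP h1).neg
  rw [map_sub] at h3
  symm
  rw [← sub_eq_zero]
  ext p s
  by_contra h
  rw [← sub_eq_add_neg] at h4
  exact h3 p s h (h4 p s h)

theorem lift_step {ι κ μ : Type} {di : ι → ℕ} {dk : κ → ℕ} {dm : μ → ℕ}
    {d : (κ →₀ MvPolynomial V k) →ₗ[MvPolynomial V k] (μ →₀ MvPolynomial V k)}
    (hd : Gr dk dm d)
    {h : (ι →₀ MvPolynomial V k) →ₗ[MvPolynomial V k] (μ →₀ MvPolynomial V k)}
    (hh : Gr di dm h) (hr : ∀ x, h x ∈ LinearMap.range d) :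
    ∃ f : (ι →₀ MvPolynomial V k) →ₗ[MvPolynomial V k] (κ →₀ MvPolynomial V k),
      Gr di dk f ∧ ∀ x, d (f x) = h x := by
  choose x hx hx' using fun a => exists_hom_preimage hd (di a) _ (hh a) (hr (Finsupp.single a 1))
  refine ⟨Finsupp.linearCombination _ x, fun a => ?_, fun z => ?_⟩
  · rw [Finsupp.linearCombination_single, one_smul]
    exact hx a
  · rw [← LinearMap.comp_apply]
    congr 1
    ext a : 2
    simp [hx']

theorem lift_step' {ι κ μ : Type}
    {d : (κ →₀ MvPolynomial V k) →ₗ[MvPolynomial V k] (μ →₀ MvPolynomial V k)}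
    {h : (ι →₀ MvPolynomial V k) →ₗ[MvPolynomial V k] (μ →₀ MvPolynomial V k)}
    (hr : ∀ x, h x ∈ LinearMap.range d) :
    ∃ f : (ι →₀ MvPolynomial V k) →ₗ[MvPolynomial V k] (κ →₀ MvPolynomial V k),
      ∀ x, d (f x) = h x := by
  choose x hx' using fun a => hr (Finsupp.single a 1)
  refine ⟨Finsupp.linearCombination _ x, fun z => ?_⟩
  rw [← LinearMap.comp_apply]
  congr 1
  ext a : 2
  simp [hx']

/-- resolution data with arbitrary index types and no explicit augmentation -/
structure Res (k V : Type) [Field k] (I : Ideal (MvPolynomial V k)) where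
  ι : ℕ → Type
  deg : ∀ i, ι i → ℕ
  d : ∀ i, (ι (i + 1) →₀ MvPolynomial V k) →ₗ[MvPolynomial V k] (ι i →₀ MvPolynomial V k)
  base : ι 0
  base_uniq : ∀ a, a = base
  deg_base : deg 0 base = 0
  range_zero : ∀ x, x ∈ LinearMap.range (d 0) ↔ x base ∈ I
  exact : ∀ i x, d i x = 0 ↔ x ∈ LinearMap.range (d (i + 1))
  minimal : ∀ i x p, constantCoeff (d i x p) = 0
  graded : ∀ i, Gr (deg (i + 1)) (deg i) (d i)

theorem Res.dd {I : Ideal (MvPolynomial V k)} (F : Res k V I) (i : ℕ) (x) :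
    F.d i (F.d (i + 1) x) = 0 := (F.exact i _).2 ⟨x, rfl⟩

/-- Lifting of a degree zero map to a chain map, with internal degree shift `e`. -/
theorem exists_lift {I J : Ideal (MvPolynomial V k)} (F : Res k V I) (G : Res k V J) (e : ℕ)
    (f0 : (F.ι 0 →₀ MvPolynomial V k) →ₗ[MvPolynomial V k] (G.ι 0 →₀ MvPolynomial V k))
    (hf0 : Gr (fun a => F.deg 0 a + e) (G.deg 0) f0)
    (h0 : ∀ x, f0 (F.d 0 x) ∈ LinearMap.range (G.d 0)) :
    ∃ f : ∀ i, (F.ι i →₀ MvPolynomial V k) →ₗ[MvPolynomial V k] (G.ι i →₀ MvPolynomial V k),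
      f 0 = f0 ∧ (∀ i, Gr (fun a => F.deg i a + e) (G.deg i) (f i)) ∧
      ∀ i x, G.d i (f (i + 1) x) = f i (F.d i x) := by
  have hs : ∀ i, Gr (fun a => F.deg (i + 1) a + e) (fun a => F.deg i a + e) (F.d i) := by
    intro i a p s h
    have := F.graded i a p s h
    simp only at this ⊢
    omega
  have step : ∀ (i : ℕ) (f : {f : (F.ι i →₀ MvPolynomial V k) →ₗ[MvPolynomial V k]
      (G.ι i →₀ MvPolynomial V k) // Gr (fun a => F.deg i a + e) (G.deg i) f ∧
        ∀ x, f (F.d i x) ∈ LinearMap.range (G.d i)}),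
      ∃ f' : {f : (F.ι (i + 1) →₀ MvPolynomial V k) →ₗ[MvPolynomial V k]
      (G.ι (i + 1) →₀ MvPolynomial V k) // Gr (fun a => F.deg (i + 1) a + e) (G.deg (i + 1)) f ∧
        ∀ x, f (F.d (i + 1) x) ∈ LinearMap.range (G.d (i + 1))},
        ∀ x, G.d i (f'.1 x) = f.1 (F.d i x) := by
    rintro i ⟨f, hf, hr⟩
    obtain ⟨f', h1, h2⟩ := lift_step (G.graded i) (hf.comp (hs i)) hr
    refine ⟨⟨f', h1, fun x => ?_⟩, h2⟩
    rw [← G.exact, h2, LinearMap.comp_apply, F.dd, map_zero]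
  choose nxt hnxt using step
  let S : ∀ i, {f : (F.ι i →₀ MvPolynomial V k) →ₗ[MvPolynomial V k]
      (G.ι i →₀ MvPolynomial V k) // Gr (fun a => F.deg i a + e) (G.deg i) f ∧
        ∀ x, f (F.d i x) ∈ LinearMap.range (G.d i)} :=
    fun i => Nat.rec ⟨f0, hf0, h0⟩ (fun i f => nxt i f) i
  exact ⟨fun i => (S i).1, rfl, fun i => (S i).2.1, fun i x => hnxt i (S i) x⟩

theorem cc_map {ι κ : Type}
    (f : (ι →₀ MvPolynomial V k) →ₗ[MvPolynomial V k] (κ →₀ MvPolynomial V k))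
    (x : ι →₀ MvPolynomial V k) (hx : ∀ a, constantCoeff (x a) = 0) (p : κ) :
    constantCoeff (f x p) = 0 := by
  rw [map_eq_sum, map_sum]
  refine Finset.sum_eq_zero fun a _ => ?_
  rw [map_mul, hx, zero_mul]

/-- a chain endomorphism which vanishes in degree `0` is zero modulo the maximal ideal -/
theorem homotopy {I : Ideal (MvPolynomial V k)} (F : Res k V I)
    (u : ∀ i, (F.ι i →₀ MvPolynomial V k) →ₗ[MvPolynomial V k] (F.ι i →₀ MvPolynomial V k))
    (hu0 : ∀ x, u 0 x = 0)
    (hu : ∀ i x, F.d i (u (i + 1) x) = u i (F.d i x)) (i : ℕ) (x : F.ι i →₀ MvPolynomial V k) (p) :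
    constantCoeff (u i x p) = 0 := by
  have key : ∀ i, (∀ x p, constantCoeff (u i x p) = 0) ∧
      ∃ s : (F.ι i →₀ MvPolynomial V k) →ₗ[MvPolynomial V k] (F.ι (i + 1) →₀ MvPolynomial V k),
        ∀ x, F.d i (s (F.d i x)) = u i (F.d i x) := by
    intro i
    induction i with
    | zero => exact ⟨fun x p => by simp [hu0], 0, fun x => by simp [hu0]⟩
    | succ i ih =>
      obtain ⟨-, s, hs⟩ := ih
      obtain ⟨s', hs'⟩ := lift_step' (d := F.d (i + 1)) (h := u (i + 1) - s ∘ₗ F.d i) (by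
        intro x
        rw [← F.exact]
        simp [hu, hs])
      refine ⟨fun x p => ?_, s', fun x => ?_⟩
      · have : u (i + 1) x = F.d (i + 1) (s' x) + s (F.d i x) := by
          rw [hs']; simp
        rw [this, Finsupp.add_apply, map_add, F.minimal, cc_map _ _ (F.minimal i x), add_zero]
      · rw [hs']
        simp [F.dd]
  exact (key i).1 x p

theorem res_le {I : Ideal (MvPolynomial V k)} (F G : Res k V I) (i j : ℕ)
    [Fintype {a : F.ι i // F.deg i a = j}] [Fintype {a : G.ι i // G.deg i a = j}] :
    Fintype.card {a : F.ι i // F.deg i a = j} ≤ Fintype.card {a : G.ι i // G.deg i a = j} := by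
  classical
  have main : ∀ F G : Res k V I, ∃ f0 : (F.ι 0 →₀ MvPolynomial V k) →ₗ[MvPolynomial V k]
      (G.ι 0 →₀ MvPolynomial V k), (∀ x, f0 x = Finsupp.single G.base (x F.base)) ∧
      Gr (fun a => F.deg 0 a + 0) (G.deg 0) f0 ∧
      ∀ x, f0 (F.d 0 x) ∈ LinearMap.range (G.d 0) := by
    intro F G
    refine ⟨Finsupp.lsingle G.base ∘ₗ Finsupp.lapply F.base, fun x => rfl, ?_, ?_⟩
    · intro a p s hs
      rw [F.base_uniq a, G.base_uniq p] at *
      simp [coeff_one] at hs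
      simp [F.deg_base, G.deg_base, ← hs]
    · intro x
      rw [G.range_zero]
      simpa using (F.range_zero _).1 ⟨x, rfl⟩
  obtain ⟨f0, hf0, hf0', hf0''⟩ := main F G
  obtain ⟨g0, hg0, hg0', hg0''⟩ := main G F
  obtain ⟨f, f1, f2, f3⟩ := exists_lift F G 0 f0 hf0' hf0''
  obtain ⟨g, g1, g2, g3⟩ := exists_lift G F 0 g0 hg0' hg0''
  have hh := homotopy F (fun i => g i ∘ₗ f i - LinearMap.id) (by
    intro x
    ext a : 1
    rw [F.base_uniq a]
    simp [f1, g1, hf0, hg0]) (by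
    intro i x
    simp [g3, f3]) i
  let A : Matrix {a : F.ι i // F.deg i a = j} {a : G.ι i // G.deg i a = j} k :=
    fun a c => constantCoeff (f i (Finsupp.single a.1 1) c.1)
  let B : Matrix {a : G.ι i // G.deg i a = j} {a : F.ι i // F.deg i a = j} k :=
    fun c b => constantCoeff (g i (Finsupp.single c.1 1) b.1)
  have hAB : A * B = 1 := by
    ext a b
    have h1 := hh (Finsupp.single a.1 1) b.1
    simp only [LinearMap.sub_apply, LinearMap.comp_apply, LinearMap.id_apply,
      Finsupp.sub_apply, map_sub, sub_eq_zero] at h1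
    have h2 : constantCoeff ((Finsupp.single a.1 (1 : MvPolynomial V k)) b.1) =
        (1 : Matrix {a : F.ι i // F.deg i a = j} {a : F.ι i // F.deg i a = j} k) a b := by
      rw [Finsupp.single_apply, Matrix.one_apply]
      by_cases h : a = b
      · simp [h]
      · rw [if_neg h, if_neg (fun h' => h (Subtype.ext h')), map_zero]
    rw [← h2, ← h1, map_eq_sum, map_sum, Matrix.mul_apply]
    simp only [map_mul, A, B]
    set y := f i (Finsupp.single a.1 1) with hy
    have h0 : ∀ c, constantCoeff (y c) ≠ 0 → G.deg i c = j := by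
      intro c hc
      have := f2 i a.1 c 0 hc
      simpa [a.2] using this
    refine (Finset.sum_map Finset.univ (Function.Embedding.subtype (fun c => G.deg i c = j))
      (fun c => constantCoeff (y c) * constantCoeff (g i (Finsupp.single c 1) b.1))).symm.trans ?_
    refine Finset.sum_congr_of_eq_on_inter ?_ ?_ (fun _ _ _ => rfl)
    · intro c _ hc
      rw [Finsupp.notMem_support_iff.1 hc, map_zero, zero_mul]
    · intro c _ hc
      by_cases h : constantCoeff (y c) = 0
      · rw [h, zero_mul]
      · exact absurd (by simpa using h0 c h) hc
  have h3 := Matrix.rank_mul_le_left A B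
  rw [hAB, Matrix.rank_one] at h3
  exact h3.trans (Matrix.rank_le_card_width A)

section cone

variable {J K : Ideal (MvPolynomial V k)} (F : Res k V J) (G : Res k V K)

def coneι : ℕ → Type
  | 0 => F.ι 0
  | i + 1 => F.ι (i + 1) ⊕ G.ι i

def coneDeg (c : ℕ) : ∀ i, coneι F G i → ℕ
  | 0 => F.deg 0
  | i + 1 => Sum.elim (F.deg (i + 1)) (fun b => G.deg i b + c)

/-- first component -/
noncomputable def pF (i : ℕ) : (coneι F G (i + 1) →₀ MvPolynomial V k) →ₗ[MvPolynomial V k]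
    (F.ι (i + 1) →₀ MvPolynomial V k) :=
  LinearMap.fst _ _ _ ∘ₗ (Finsupp.sumFinsuppLEquivProdFinsupp (MvPolynomial V k)
    (α := F.ι (i + 1)) (β := G.ι i)).toLinearMap

/-- second component -/
noncomputable def pG (i : ℕ) : (coneι F G (i + 1) →₀ MvPolynomial V k) →ₗ[MvPolynomial V k]
    (G.ι i →₀ MvPolynomial V k) :=
  LinearMap.snd _ _ _ ∘ₗ (Finsupp.sumFinsuppLEquivProdFinsupp (MvPolynomial V k)
    (α := F.ι (i + 1)) (β := G.ι i)).toLinearMap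

/-- pairing -/
noncomputable def mk (i : ℕ) : (F.ι (i + 1) →₀ MvPolynomial V k) × (G.ι i →₀ MvPolynomial V k)
    →ₗ[MvPolynomial V k] (coneι F G (i + 1) →₀ MvPolynomial V k) :=
  (Finsupp.sumFinsuppLEquivProdFinsupp (MvPolynomial V k)
    (α := F.ι (i + 1)) (β := G.ι i)).symm.toLinearMap

@[simp] theorem pF_mk (i : ℕ) (x) : pF F G i (mk F G i x) = x.1 :=
  congrArg Prod.fst (LinearEquiv.apply_symm_apply (Finsupp.sumFinsuppLEquivProdFinsupp (MvPolynomial V k)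
    (α := F.ι (i + 1)) (β := G.ι i)) x)
@[simp] theorem pG_mk (i : ℕ) (x) : pG F G i (mk F G i x) = x.2 :=
  congrArg Prod.snd (LinearEquiv.apply_symm_apply (Finsupp.sumFinsuppLEquivProdFinsupp (MvPolynomial V k)
    (α := F.ι (i + 1)) (β := G.ι i)) x)
theorem mk_p (i : ℕ) (x) : mk F G i (pF F G i x, pG F G i x) = x :=
  LinearEquiv.symm_apply_apply (Finsupp.sumFinsuppLEquivProdFinsupp (MvPolynomial V k)
    (α := F.ι (i + 1)) (β := G.ι i)) x
theorem mk_inl (i : ℕ) (x) (a : F.ι (i + 1)) : mk F G i x (Sum.inl a : F.ι (i + 1) ⊕ G.ι i) = x.1 a := by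
  exact Finsupp.sumFinsuppLEquivProdFinsupp_symm_inl _ x a
theorem mk_inr (i : ℕ) (x) (a : G.ι i) : mk F G i x (Sum.inr a : F.ι (i + 1) ⊕ G.ι i) = x.2 a := by
  exact Finsupp.sumFinsuppLEquivProdFinsupp_symm_inr _ x a
theorem p_ext (i : ℕ) (x y) (h1 : pF F G i x = pF F G i y) (h2 : pG F G i x = pG F G i y) :
    x = y := by
  rw [← mk_p F G i x, ← mk_p F G i y, h1, h2]

theorem aux_ll {α β : Type} (a b : α) (r : MvPolynomial V k) :
    (Finsupp.single (Sum.inl a : α ⊕ β) r) (Sum.inl b) = Finsupp.single a r b := by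
  classical simp [Finsupp.single_apply]
theorem aux_rr {α β : Type} (a b : β) (r : MvPolynomial V k) :
    (Finsupp.single (Sum.inr a : α ⊕ β) r) (Sum.inr b) = Finsupp.single a r b := by
  classical simp [Finsupp.single_apply]
theorem aux_lr {α β : Type} (a : α) (b : β) (r : MvPolynomial V k) :
    (Finsupp.single (Sum.inl a : α ⊕ β) r) (Sum.inr b) = 0 := by
  classical simp
theorem aux_rl {α β : Type} (a : β) (b : α) (r : MvPolynomial V k) :
    (Finsupp.single (Sum.inr a : α ⊕ β) r) (Sum.inl b) = 0 := by
  classical simp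

theorem pF_inl (i : ℕ) (a : F.ι (i + 1)) (r : MvPolynomial V k) :
    pF F G i (Finsupp.single (Sum.inl a : F.ι (i + 1) ⊕ G.ι i) r) = Finsupp.single a r := by
  classical
  ext b : 1
  exact (Finsupp.fst_sumFinsuppLEquivProdFinsupp (MvPolynomial V k) _ b).trans (aux_ll a b r)
theorem pF_inr (i : ℕ) (a : G.ι i) (r : MvPolynomial V k) :
    pF F G i (Finsupp.single (Sum.inr a : F.ι (i + 1) ⊕ G.ι i) r) = 0 := by
  classical
  ext b : 1
  exact (Finsupp.fst_sumFinsuppLEquivProdFinsupp (MvPolynomial V k) _ b).trans (aux_rl a b r)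
theorem pG_inl (i : ℕ) (a : F.ι (i + 1)) (r : MvPolynomial V k) :
    pG F G i (Finsupp.single (Sum.inl a : F.ι (i + 1) ⊕ G.ι i) r) = 0 := by
  classical
  ext b : 1
  exact (Finsupp.snd_sumFinsuppLEquivProdFinsupp (MvPolynomial V k) _ b).trans (aux_lr a b r)
theorem pG_inr (i : ℕ) (a : G.ι i) (r : MvPolynomial V k) :
    pG F G i (Finsupp.single (Sum.inr a : F.ι (i + 1) ⊕ G.ι i) r) = Finsupp.single a r := by
  classical
  ext b : 1
  exact (Finsupp.snd_sumFinsuppLEquivProdFinsupp (MvPolynomial V k) _ b).trans (aux_rr a b r)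

variable (ψ : ∀ i, (G.ι i →₀ MvPolynomial V k) →ₗ[MvPolynomial V k] (F.ι i →₀ MvPolynomial V k))

noncomputable def coneD : ∀ i, (coneι F G (i + 1) →₀ MvPolynomial V k) →ₗ[MvPolynomial V k]
    (coneι F G i →₀ MvPolynomial V k)
  | 0 => F.d 0 ∘ₗ pF F G 0 + ψ 0 ∘ₗ pG F G 0
  | i + 1 => mk F G i ∘ₗ
      ((F.d (i + 1) ∘ₗ pF F G (i + 1) + ψ (i + 1) ∘ₗ pG F G (i + 1)).prod
        (- (G.d i ∘ₗ pG F G (i + 1))))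

theorem coneD_zero (x) : coneD F G ψ 0 x = (F.d 0 (pF F G 0 x) + ψ 0 (pG F G 0 x) :) := rfl
theorem coneD_succ (i : ℕ) (x) : coneD F G ψ (i + 1) x =
    mk F G i (F.d (i + 1) (pF F G (i + 1) x) + ψ (i + 1) (pG F G (i + 1) x),
      -(G.d i (pG F G (i + 1) x))) := rfl

theorem DegP.zero {ι : Type} {deg : ι → ℕ} {P : ℕ → Prop} :
    DegP k V deg P (0 : ι →₀ MvPolynomial V k) := by
  intro p s hs
  simp at hs

theorem DegP.mk {i c : ℕ} {P : ℕ → Prop} {x : F.ι (i + 1) →₀ MvPolynomial V k}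
    {y : G.ι i →₀ MvPolynomial V k} (hx : DegP k V (F.deg (i + 1)) P x)
    (hy : DegP k V (fun b => G.deg i b + c) P y) :
    DegP k V (coneDeg F G c (i + 1)) P (mk F G i (x, y)) := by
  rintro (p | p) s hs
  · rw [mk_inl] at hs
    exact hx p s hs
  · rw [mk_inr] at hs
    exact hy p s hs

/-- The mapping cone. -/
noncomputable def cone {I : Ideal (MvPolynomial V k)} (c : ℕ) (m : MvPolynomial V k)
    (hψ : ∀ i x, F.d i (ψ (i + 1) x) = ψ i (G.d i x))
    (hgr : ∀ i, Gr (fun a => G.deg i a + c) (F.deg i) (ψ i))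
    (hmin : ∀ i x p, constantCoeff (ψ i x p) = 0)
    (h0 : ∀ x, ψ 0 x F.base = m * x G.base)
    (hK : ∀ r, m * r ∈ J → r ∈ K)
    (hI : ∀ r, r ∈ I ↔ ∃ a ∈ J, ∃ b, r = a + m * b) : Res k V I where
  ι := coneι F G
  deg := coneDeg F G c
  d := coneD F G ψ
  base := F.base
  base_uniq := F.base_uniq
  deg_base := F.deg_base
  range_zero := by
    intro x
    rw [hI]
    constructor
    · rintro ⟨z, rfl⟩
      exact ⟨_, (F.range_zero _).1 ⟨pF F G 0 z, rfl⟩, pG F G 0 z G.base, by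
        rw [← h0, coneD_zero]; rfl⟩
    · rintro ⟨a, ha, b, hab⟩
      obtain ⟨z, hz⟩ := (F.range_zero (Finsupp.single F.base a)).2 (by simpa using ha)
      refine ⟨mk F G 0 (z, Finsupp.single G.base b), ?_⟩
      rw [coneD_zero, pF_mk, pG_mk, hz]
      refine Finsupp.ext fun p => ?_
      obtain rfl : p = F.base := F.base_uniq p
      refine Eq.trans ?_ hab.symm
      have := h0 (Finsupp.single G.base b)
      rw [Finsupp.single_eq_same] at this
      rw [← this]
      exact congrArg (fun t => t + ψ 0 (Finsupp.single G.base b) F.base) Finsupp.single_eq_same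
  exact := by
    have key : ∀ i x c', F.d i (pF F G i x) + ψ i (pG F G i x) = 0 →
        pG F G i x = -G.d i c' → x ∈ LinearMap.range (coneD F G ψ (i + 1)) := by
      intro i x c' h1 h2
      rw [h2, map_neg, ← hψ, ← sub_eq_add_neg, ← map_sub, F.exact] at h1
      obtain ⟨z, hz⟩ := h1
      refine ⟨mk F G (i + 1) (z, c'), ?_⟩
      rw [coneD_succ]
      apply p_ext
      · simp [hz]
      · simp [h2]
    intro i x
    constructor
    · intro h
      cases i with
      | zero =>
        rw [coneD_zero] at h
        have h1 : F.d 0 (pF F G 0 x) F.base + m * pG F G 0 x G.base = 0 := by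
          rw [← h0]
          exact DFunLike.congr_fun h F.base
        have h2 : F.d 0 (pF F G 0 x) F.base ∈ J := (F.range_zero _).1 ⟨_, rfl⟩
        have h3 : pG F G 0 x G.base ∈ K := by
          apply hK
          rw [← neg_eq_iff_add_eq_zero] at h1
          rw [← h1]
          exact J.neg_mem h2
        obtain ⟨c', hc⟩ := (G.range_zero _).2 h3
        exact key 0 x (-c') h (by rw [map_neg, neg_neg, hc])
      | succ i =>
        rw [coneD_succ] at h
        have h1 := congrArg (pF F G i) h
        have h2 := congrArg (pG F G i) h
        simp only [pF_mk, pG_mk, map_zero, neg_eq_zero] at h1 h2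
        obtain ⟨c', hc⟩ := (G.exact _ _).1 h2
        exact key (i + 1) x (-c') h1 (by rw [map_neg, neg_neg, hc])
    · rintro ⟨z, rfl⟩
      cases i with
      | zero =>
        rw [coneD_zero, coneD_succ]
        simp [F.dd, hψ]
        rfl
      | succ i =>
        rw [coneD_succ, coneD_succ]
        simp only [pF_mk, pG_mk, map_add, map_neg, F.dd, G.dd, hψ, zero_add, add_neg_cancel, neg_zero]
        exact map_zero _
  minimal := by
    intro i x p
    cases i with
    | zero =>
      rw [coneD_zero]
      show constantCoeff (F.d 0 (pF F G 0 x) p + ψ 0 (pG F G 0 x) p) = 0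
      rw [map_add]
      exact (congrArg₂ (· + ·) (F.minimal 0 _ p) (hmin 0 _ p)).trans (add_zero 0)
    | succ i =>
      rw [coneD_succ]
      obtain p | p := p
      · rw [mk_inl]
        simp [F.minimal, hmin]
      · rw [mk_inr]
        simp [G.minimal]
  graded := by
    have hG : ∀ i, Gr (fun a => G.deg (i + 1) a + c) (fun a => G.deg i a + c) (G.d i) := by
      intro i a p s h
      have := G.graded i a p s h
      simp only at this ⊢
      omega
    intro i a
    cases i with
    | zero =>
      rw [coneD_zero]
      obtain a | a := a
      · rw [pF_inl, pG_inl, map_zero, add_zero]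
        exact F.graded 0 a
      · rw [pF_inr, pG_inr, map_zero]
        have := hgr 0 a
        rw [← zero_add (ψ 0 _)] at this
        exact this
    | succ i =>
      rw [coneD_succ]
      obtain a | a := a
      · rw [pF_inl, pG_inl, map_zero, add_zero, map_zero, neg_zero]
        exact DegP.mk F G (F.graded (i + 1) a) DegP.zero
      · rw [pF_inr, pG_inr, map_zero, zero_add]
        exact DegP.mk F G (hgr (i + 1) a) (hG i a).neg

end cone

noncomputable def zeroRes : Res k V ⊥ where
  ι := fun i => match i with
    | 0 => Unit
    | _ + 1 => Empty
  deg := fun _ _ => 0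
  d := fun _ => 0
  base := ()
  base_uniq := fun _ => rfl
  deg_base := rfl
  range_zero := by
    intro x
    constructor
    · rintro ⟨z, rfl⟩
      simp
    · intro h
      refine ⟨0, ?_⟩
      rw [map_zero]
      refine Finsupp.ext fun p => ?_
      exact (Ideal.mem_bot.1 h).symm
  exact := by
    intro i x
    have : x = 0 := Finsupp.ext fun p => by cases p
    simp [this]
  minimal := by intro i x p; simp
  graded := by intro i a p s hs; simp at hs

section edges
variable [DecidableEq V]

noncomputable def sqIdeal (k : Type) [Field k] (n : ℕ) (E : ℕ → Finset V) : Ideal (MvPolynomial V k) :=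
  Ideal.span {r | ∃ i < n, r = ∏ v ∈ E i, X v}

noncomputable def ind (S : Finset V) : V →₀ ℕ := ∑ v ∈ S, Finsupp.single v 1

theorem prod_X_eq (S : Finset V) : ∏ v ∈ S, (X v : MvPolynomial V k) = monomial (ind S) 1 := by
  rw [ind, monomial_sum_one]; rfl

theorem ind_apply (S : Finset V) (w : V) : ind S w = if w ∈ S then 1 else 0 := by
  simp [ind, Finsupp.finsetSum_apply, Finsupp.single_apply]

theorem ind_degree (S : Finset V) : (ind S).degree = S.card := by
  simp [ind]

theorem mem_sqIdeal (n : ℕ) (E : ℕ → Finset V) (r : MvPolynomial V k) :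
    r ∈ sqIdeal k n E ↔ ∀ s, coeff s r ≠ 0 → ∃ i < n, ∀ v ∈ E i, s v ≠ 0 := by
  have : {r : MvPolynomial V k | ∃ i < n, r = ∏ v ∈ E i, X v} =
      (fun s => monomial s (1 : k)) '' {s | ∃ i < n, s = ind (E i)} := by
    ext r
    constructor
    · rintro ⟨i, hi, rfl⟩
      exact ⟨_, ⟨i, hi, rfl⟩, (prod_X_eq _).symm⟩
    · rintro ⟨_, ⟨i, hi, rfl⟩, rfl⟩
      exact ⟨i, hi, (prod_X_eq _).symm⟩
  rw [sqIdeal, this, mem_ideal_span_monomial_image]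
  refine forall_congr' fun s => ?_
  rw [mem_support_iff]
  refine imp_congr_right fun _ => ?_
  constructor
  · rintro ⟨_, ⟨i, hi, rfl⟩, h⟩
    refine ⟨i, hi, fun v hv => ?_⟩
    have := h v
    rw [ind_apply, if_pos hv] at this
    omega
  · rintro ⟨i, hi, h⟩
    refine ⟨_, ⟨i, hi, rfl⟩, fun v => ?_⟩
    rw [ind_apply]
    split_ifs with hv
    · exact Nat.one_le_iff_ne_zero.2 (h v hv)
    · exact Nat.zero_le _

theorem colon (n : ℕ) (E : ℕ → Finset V) (S : Finset V) (r : MvPolynomial V k) :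
    (∏ v ∈ S, X v) * r ∈ sqIdeal k n E ↔ r ∈ sqIdeal k n (fun i => E i \ S) := by
  rw [mem_sqIdeal, mem_sqIdeal, prod_X_eq]
  constructor
  · intro h s hs
    obtain ⟨i, hi, h'⟩ := h (ind S + s) (by rwa [coeff_monomial_mul, one_mul])
    refine ⟨i, hi, fun v hv => ?_⟩
    rw [Finset.mem_sdiff] at hv
    have := h' v hv.1
    rwa [Finsupp.add_apply, ind_apply, if_neg hv.2, zero_add] at this
  · intro h s hs
    rw [coeff_monomial_mul'] at hs
    split_ifs at hs with hle
    · rw [one_mul] at hs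
      obtain ⟨i, hi, h'⟩ := h _ hs
      refine ⟨i, hi, fun v hv => ?_⟩
      by_cases hS : v ∈ S
      · have := hle v
        rw [ind_apply, if_pos hS] at this
        omega
      · have := h' v (Finset.mem_sdiff.2 ⟨hv, hS⟩)
        rw [Finsupp.tsub_apply] at this
        omega
    · exact absurd rfl hs

theorem sqIdeal_congr (n : ℕ) (E E' : ℕ → Finset V) (h : ∀ i < n, E i = E' i) :
    sqIdeal k n E = sqIdeal k n E' := by
  ext r
  rw [mem_sqIdeal, mem_sqIdeal]
  refine forall_congr' fun s => imp_congr_right fun _ => exists_congr fun i => ?_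
  exact and_congr_right fun hi => by rw [h i hi]

theorem sqIdeal_succ (n : ℕ) (E : ℕ → Finset V) :
    sqIdeal k (n + 1) E = sqIdeal k n E ⊔ Ideal.span {∏ v ∈ E n, X v} := by
  rw [sqIdeal, sqIdeal, ← Ideal.span_union]
  congr 1
  ext r
  simp only [Set.mem_ofPred_eq, Set.mem_union, Set.mem_singleton_iff, Nat.lt_succ_iff_lt_or_eq]
  constructor
  · rintro ⟨i, hi | rfl, h⟩
    · exact Or.inl ⟨i, hi, h⟩
    · exact Or.inr h
  · rintro (⟨i, hi, h⟩ | h)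
    · exact ⟨i, Or.inl hi, h⟩
    · exact ⟨n, Or.inr rfl, h⟩

theorem exists_res (n : ℕ) : ∀ E : ℕ → Finset V,
    (∀ i < n, ∃ v ∈ E i, ∀ j < n, j ≠ i → v ∉ E j) →
    ∃ G : Res k V (sqIdeal k n E), (∀ i, n < i → IsEmpty (G.ι i)) ∧
      ∃ a : G.ι n, (∀ b, b = a) ∧ G.deg n a = ((Finset.range n).biUnion E).card := by
  induction n with
  | zero =>
    intro E _
    have : sqIdeal k 0 E = ⊥ := by simp [sqIdeal]
    rw [this]
    refine ⟨zeroRes, ?_, ?_⟩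
    · rintro (_ | i) hi
      · omega
      · exact inferInstanceAs (IsEmpty Empty)
    · exact ⟨(), fun _ => rfl, rfl⟩
  | succ n ih =>
    intro E hE
    obtain ⟨y, hy, hy'⟩ := hE n (Nat.lt_succ_self n)
    have hyE : ∀ i < n, y ∉ E i := fun i hi => hy' i (by omega) (by omega)
    set S := (E n).erase y with hS
    obtain ⟨F, hF, -⟩ := ih E (fun i hi => by
      obtain ⟨v, hv, hv'⟩ := hE i (by omega)
      exact ⟨v, hv, fun j hj => hv' j (by omega)⟩)
    obtain ⟨G, hG, a, ha, hdeg⟩ := ih (fun i => E i \ S) (fun i hi => by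
      obtain ⟨v, hv, hv'⟩ := hE i (by omega)
      refine ⟨v, Finset.mem_sdiff.2 ⟨hv, fun h => ?_⟩, fun j hj hji h => ?_⟩
      · exact hv' n (by omega) (by omega) (Finset.mem_of_mem_erase h)
      · exact hv' j (by omega) hji (Finset.mem_sdiff.1 h).1)
    obtain ⟨f, f1, f2, f3⟩ := exists_lift G F S.card
      (Finsupp.lsingle F.base ∘ₗ ((∏ v ∈ S, X v : MvPolynomial V k) • Finsupp.lapply G.base))
      (by
        intro a p s hs
        rw [G.base_uniq a, F.base_uniq p] at *
        simp only [LinearMap.comp_apply, LinearMap.smul_apply, Finsupp.lapply_apply,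
          Finsupp.lsingle_apply, Finsupp.single_eq_same, smul_eq_mul, mul_one] at hs
        rw [prod_X_eq, coeff_monomial] at hs
        split_ifs at hs with h
        · simp [← h, ind_degree, F.deg_base, G.deg_base]
        · exact absurd rfl hs)
      (by
        intro x
        rw [F.range_zero]
        simp only [LinearMap.comp_apply, LinearMap.smul_apply, Finsupp.lapply_apply,
          Finsupp.lsingle_apply, Finsupp.single_eq_same, smul_eq_mul]
        rw [colon]
        exact (G.range_zero _).1 ⟨x, rfl⟩)
    have hprod : (X y : MvPolynomial V k) * ∏ v ∈ S, X v = ∏ v ∈ E n, X v :=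
      Finset.mul_prod_erase _ _ hy
    refine ⟨cone F G (fun i => (X y : MvPolynomial V k) • f i) (S.card + 1)
      (X y * ∏ v ∈ S, X v) ?_ ?_ ?_ ?_ ?_ ?_, ?_, ?_⟩
    · intro i x
      simp [f3]
    · intro i a p s hs
      simp only [LinearMap.smul_apply, Finsupp.smul_apply, smul_eq_mul] at hs
      rw [coeff_X_mul'] at hs
      split_ifs at hs with h
      · have h1 := f2 i a p _ hs
        simp only at h1 ⊢
        have h2 : s = (s - Finsupp.single y 1) + Finsupp.single y 1 := by
          rw [tsub_add_cancel_of_le]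
          rw [Finsupp.single_le_iff]
          exact Nat.one_le_iff_ne_zero.2 (Finsupp.mem_support_iff.1 h)
        rw [h2, map_add, Finsupp.degree_single]
        omega
      · exact absurd rfl hs
    · intro i x p
      simp
    · intro x
      simp [f1, mul_assoc]
    · intro r hr
      rw [← colon]
      have h1 := colon n E {y} ((∏ v ∈ S, X v) * r)
      rw [Finset.prod_singleton, ← mul_assoc] at h1
      rw [sqIdeal_congr n E (fun i => E i \ {y}) (fun i hi => by
        rw [Finset.sdiff_singleton_eq_erase, Finset.erase_eq_of_notMem (hyE i hi)])]
      exact h1.1 hr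
    · intro r
      rw [sqIdeal_succ, Submodule.mem_sup, hprod]
      refine exists_congr fun a => and_congr_right fun _ => ?_
      constructor
      · rintro ⟨z, hz, rfl⟩
        obtain ⟨b, rfl⟩ := Ideal.mem_span_singleton.1 hz
        exact ⟨b, rfl⟩
      · rintro ⟨b, rfl⟩
        exact ⟨_, Ideal.mem_span_singleton.2 ⟨b, rfl⟩, rfl⟩
    · rintro (_ | i) hi
      · omega
      · have := hF (i + 1) (by omega)
        have := hG i (by omega)
        exact inferInstanceAs (IsEmpty (F.ι (i + 1) ⊕ G.ι i))
    · have := hF (n + 1) (by omega)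
      refine ⟨(Sum.inr a : F.ι (n + 1) ⊕ G.ι n), ?_, ?_⟩
      · rintro (b | b)
        · exact isEmptyElim b
        · rw [ha b]
      · show G.deg n a + (S.card + 1) = _
        rw [hdeg]
        have h1 : S.card + 1 = (E n).card := Finset.card_erase_add_one hy
        rw [h1, ← Finset.card_union_of_disjoint]
        · congr 1
          ext v
          simp only [Finset.mem_union, Finset.mem_biUnion, Finset.mem_range, Finset.mem_sdiff,
            Nat.lt_succ_iff_lt_or_eq]
          constructor
          · rintro (⟨i, hi, h, -⟩ | h)
            · exact ⟨i, Or.inl hi, h⟩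
            · exact ⟨n, Or.inr rfl, h⟩
          · rintro ⟨i, hi | rfl, h⟩
            · by_cases hv : v ∈ S
              · exact Or.inr (Finset.mem_of_mem_erase hv)
              · exact Or.inl ⟨i, hi, h, hv⟩
            · exact Or.inr h
        · rw [Finset.disjoint_left]
          intro v hv hvn
          simp only [Finset.mem_biUnion, Finset.mem_range, Finset.mem_sdiff] at hv
          obtain ⟨i, hi, h1, h2⟩ := hv
          apply h2
          rw [hS, Finset.mem_erase]
          exact ⟨fun h => hyE i hi (h ▸ h1), hvn⟩

end edges

noncomputable def toRes [Fintype V] [DecidableEq V] {I : Ideal (MvPolynomial V k)}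
    (F : MinimalGradedFreeResolution k V I) : Res k V I where
  ι := fun i => Σ j, Fin (F.β i j)
  deg := fun _ a => a.1
  d := F.d
  base := ⟨0, ⟨0, by rw [F.β_zero]; simp⟩⟩
  base_uniq := by
    rintro ⟨j, t⟩
    have h := F.β_zero j
    have ht := t.2
    by_cases hj : j = 0
    · subst hj
      rw [if_pos rfl] at h
      congr 1
      ext
      show t.1 = 0
      omega
    · rw [if_neg hj] at h
      omega
  deg_base := rfl
  range_zero := by
    intro x
    set b : Σ j, Fin (F.β 0 j) := ⟨0, ⟨0, by rw [F.β_zero]; simp⟩⟩ with hb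
    have huniq : ∀ a : (Σ j, Fin (F.β 0 j)), a = b := by
      rintro ⟨j, t⟩
      have h := F.β_zero j
      have ht := t.2
      by_cases hj : j = 0
      · subst hj
        rw [if_pos rfl] at h
        rw [hb]
        congr 1
        ext
        show t.1 = 0
        omega
      · rw [if_neg hj] at h
        omega
    have hx : ∀ x, F.aug x = x b • F.aug (Finsupp.single b 1) := by
      intro x
      rw [← map_smul]
      congr 1
      ext a : 1
      rw [huniq a]
      simp
    rw [← F.exact_zero, LinearMap.mem_ker, hx]
    obtain ⟨z, hz⟩ := F.aug_surjective 1
    rw [hx] at hz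
    have hmk : ∀ r : MvPolynomial V k, r • (1 : MvPolynomial V k ⧸ I) = 0 ↔ r ∈ I := by
      intro r
      have h : r • (1 : MvPolynomial V k ⧸ I) = Ideal.Quotient.mk I r := by
        show Ideal.Quotient.mk I (r * 1) = _
        rw [mul_one]
      rw [← Ideal.Quotient.eq_zero_iff_mem, h]
    rw [← hmk]
    constructor
    · intro h
      rw [← hz, smul_comm, h, smul_zero]
    · intro h
      have : x b • F.aug (Finsupp.single b 1) =
        (x b • (1 : MvPolynomial V k ⧸ I)) * F.aug (Finsupp.single b 1) := by
        rw [smul_mul_assoc, one_mul]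
      rw [this, h, zero_mul]
  exact := by
    intro i x
    rw [← F.exact_succ, LinearMap.mem_ker]
  minimal := F.minimal
  graded := by
    rintro i ⟨j, t⟩ p s hs
    obtain ⟨h1, h2 | h2⟩ := F.graded i j t p
    · have := h1 hs
      have h3 : s.degree = Finsupp.weight (1 : V → ℕ) s := by
        rw [Finsupp.degree_eq_weight_one]; rfl
      show s.degree + p.1 = j
      omega
    · rw [h2] at hs
      simp at hs

theorem line_card {V : Type} [Fintype V] [DecidableEq V] (n d α : ℕ) (E : ℕ → Finset V)
    (hd : 2 * α < d) (h : IsLineHypergraph n d α E) (m : ℕ) (hm : m + 1 ≤ n) :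
    ((Finset.range (m + 1)).biUnion E).card = (m + 1) * (d - α) + α := by
  induction m with
  | zero =>
    simp [h.card_eq 0 (by omega)]
    omega
  | succ m ih =>
    rw [Finset.range_add_one, Finset.biUnion_insert]
    have h1 : E (m + 1) ∩ (Finset.range (m + 1)).biUnion E = E m ∩ E (m + 1) := by
      ext v
      simp only [Finset.mem_inter, Finset.mem_biUnion, Finset.mem_range]
      constructor
      · rintro ⟨h1, i, hi, h2⟩
        have := (h.inter_nonempty_iff i (by omega) (m + 1) (by omega) (by omega)).1
          ⟨v, Finset.mem_inter.2 ⟨h2, h1⟩⟩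
        obtain rfl : i = m := by omega
        exact ⟨h2, h1⟩
      · rintro ⟨h1, h2⟩
        exact ⟨h2, m, by omega, h1⟩
    have h2 := Finset.card_union_add_card_inter (E (m + 1)) ((Finset.range (m + 1)).biUnion E)
    rw [h1, h.inter_card m (by omega), h.card_eq _ (by omega), ih (by omega)] at h2
    have h3 : (m + 1 + 1) * (d - α) = (m + 1) * (d - α) + (d - α) := by ring
    omega

theorem line_private {V : Type} [Fintype V] [DecidableEq V] (n d α : ℕ) (E : ℕ → Finset V)
    (hd : 2 * α < d) (h : IsLineHypergraph n d α E) (i : ℕ) (hi : i < n) :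
    ∃ v ∈ E i, ∀ j < n, j ≠ i → v ∉ E j := by
  by_contra! hc
  let A := if 0 < i then E (i - 1) ∩ E i else ∅
  let B := if i + 1 < n then E i ∩ E (i + 1) else ∅
  have hA : A.card ≤ α := by
    by_cases h0 : 0 < i
    · simp only [A, if_pos h0]
      have := h.inter_card (i - 1) (by omega)
      rw [Nat.sub_add_cancel h0] at this
      exact this.le
    · simp [A, if_neg h0]
  have hB : B.card ≤ α := by
    by_cases h0 : i + 1 < n
    · simp only [B, if_pos h0]
      exact (h.inter_card i h0).le
    · simp [B, if_neg h0]
  have hsub : E i ⊆ A ∪ B := by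
    intro v hv
    obtain ⟨j, hj, hji, hvj⟩ := hc v hv
    have := (h.inter_nonempty_iff i hi j hj (Ne.symm hji)).1 ⟨v, Finset.mem_inter.2 ⟨hv, hvj⟩⟩
    rw [Finset.mem_union]
    rcases this with rfl | rfl
    · right
      simp only [B, if_pos hj]
      exact Finset.mem_inter.2 ⟨hv, hvj⟩
    · left
      simp only [A, if_pos (Nat.succ_pos j), Nat.add_sub_cancel]
      exact Finset.mem_inter.2 ⟨hvj, hv⟩
  have h1 := Finset.card_le_card hsub
  have h2 := Finset.card_union_le A B
  rw [h.card_eq i hi] at h1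
  omega

/-- Let `L_n^{d,α}` be a line hypergraph with `d > 2α`.  Then the top
graded Betti numbers of `R ⧸ I(L_n^{d,α})` satisfy:
`β_{n,j} = 1` if `j = n(d - α) + α`, and `β_{n,j} = 0` for every other `j`. -/
theorem topBetti_line (k V : Type) [Field k] [Fintype V] [DecidableEq V]
    (n d α : ℕ) (E : ℕ → Finset V)
    (hn : 0 < n) (hd : 2 * α < d)
    (hline : IsLineHypergraph n d α E)
    (F : MinimalGradedFreeResolution k V (edgeIdeal k (fun i : Fin n => E i.val)))
    (j : ℕ) :
    F.β n j = if j = n * (d - α) + α then 1 else 0 := by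

  classical
  obtain ⟨m, rfl⟩ : ∃ m, n = m + 1 := ⟨n - 1, by omega⟩
  have hI : edgeIdeal k (fun i : Fin (m + 1) => E i.val) = sqIdeal k (m + 1) E := by
    rw [edgeIdeal, sqIdeal]
    congr 1
    ext r
    constructor
    · rintro ⟨i, rfl⟩
      exact ⟨i.1, i.2, rfl⟩
    · rintro ⟨i, hi, rfl⟩
      exact ⟨⟨i, hi⟩, rfl⟩
  obtain ⟨G, -, a, ha, hdeg⟩ : ∃ G : Res k V (edgeIdeal k (fun i : Fin (m + 1) => E i.val)),
      (∀ i, m + 1 < i → IsEmpty (G.ι i)) ∧ ∃ a : G.ι (m + 1), (∀ b, b = a) ∧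
        G.deg (m + 1) a = ((Finset.range (m + 1)).biUnion E).card := by
    rw [hI]
    exact exists_res (m + 1) E (line_private (m + 1) d α E hd hline)
  rw [line_card (m + 1) d α E hd hline m le_rfl] at hdeg
  have hsub : Subsingleton (G.ι (m + 1)) := ⟨fun x y => (ha x).trans (ha y).symm⟩
  let eqv : {s : (toRes F).ι (m + 1) // (toRes F).deg (m + 1) s = j} ≃ Fin (F.β (m + 1) j) :=
    Equiv.sigmaSubtype j
  haveI : Fintype {s : (toRes F).ι (m + 1) // (toRes F).deg (m + 1) s = j} :=
    Fintype.ofEquiv _ eqv.symm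
  haveI : Fintype {s : G.ι (m + 1) // G.deg (m + 1) s = j} := Fintype.ofFinite _
  have h1 := res_le (toRes F) G (m + 1) j
  have h2 := res_le G (toRes F) (m + 1) j
  have h3 := h1.antisymm h2
  rw [Fintype.card_congr eqv, Fintype.card_fin] at h3
  rw [h3]
  split_ifs with hj
  · rw [Fintype.card_eq_one_iff]
    exact ⟨⟨a, hdeg.trans hj.symm⟩, fun b => Subsingleton.elim _ _⟩
  · rw [Fintype.card_eq_zero_iff]
    refine ⟨fun b => hj ?_⟩
    rw [← b.2, ha b.1, hdeg]
end

section
/- Let L_n^{d,alpha} be a line hypergraph with d > 2*alpha and let i < n. Then for every r with 1 ≤ r ≤ i, beta_{i, i*d - alpha*(i-r)}(R/I(L_n^{d,alpha})) = C(i-1, r-1) * C(n-i+1, r), and beta_{i,j}(R/I(L_n^{d,alpha})) = 0 for every j not of the form i*d - alpha*(i-r) with 1 ≤ r ≤ i. -/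
open MvPolynomial

/-! ### Comparison of minimal graded free resolutions -/

/-- every monomial `x^m e_a` occurring in `x` has degree satisfying `P` -/
def HomP {k V A : Type} [Field k] (deg : A → ℕ) (P : ℕ → Prop)
    (x : A →₀ MvPolynomial V k) : Prop :=
  ∀ a m, coeff m (x a) ≠ 0 → P (m.degree + deg a)

/-- a degree preserving linear map between graded free modules -/
def GrMap {k V A B : Type} [Field k] (degA : A → ℕ) (degB : B → ℕ)
    (f : (A →₀ MvPolynomial V k) →ₗ[MvPolynomial V k] (B →₀ MvPolynomial V k)) : Prop :=
  ∀ a, HomP degB (fun j => j = degA a) (f (Finsupp.single a 1))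

theorem map_apply_eq_sum {k V A B : Type} [Field k]
    (f : (A →₀ MvPolynomial V k) →ₗ[MvPolynomial V k] (B →₀ MvPolynomial V k))
    (x : A →₀ MvPolynomial V k) (b : B) :
    f x b = ∑ a ∈ x.support, x a * f (Finsupp.single a 1) b := by
  conv_lhs => rw [← Finsupp.sum_single x, Finsupp.sum, map_sum]
  rw [Finsupp.finsetSum_apply]
  refine Finset.sum_congr rfl fun a _ => ?_
  have : Finsupp.single a (x a) = x a • Finsupp.single a (1 : MvPolynomial V k) := by simp
  rw [this, map_smul, Finsupp.smul_apply, smul_eq_mul]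

theorem HomP.map {k V A B : Type} [Field k] {degA : A → ℕ} {degB : B → ℕ}
    {f : (A →₀ MvPolynomial V k) →ₗ[MvPolynomial V k] (B →₀ MvPolynomial V k)}
    (hf : GrMap degA degB f) {P : ℕ → Prop} {x : A →₀ MvPolynomial V k}
    (hx : HomP degA P x) : HomP degB P (f x) := by
  classical
  intro b m hm
  rw [map_apply_eq_sum, coeff_sum] at hm
  obtain ⟨a, -, ha⟩ := Finset.exists_ne_zero_of_sum_ne_zero hm
  rw [coeff_mul] at ha
  obtain ⟨⟨m1, m2⟩, hmm, h12⟩ := Finset.exists_ne_zero_of_sum_ne_zero ha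
  have h1 := hx a m1 (left_ne_zero_of_mul h12)
  have h2 := hf a b m2 (right_ne_zero_of_mul h12)
  rw [Finset.HasAntidiagonal.mem_antidiagonal] at hmm
  simp only at hmm h2
  rw [← hmm, map_add, add_assoc, h2]
  exact h1

theorem GrMap.comp {k V A B C : Type} [Field k] {degA : A → ℕ} {degB : B → ℕ} {degC : C → ℕ}
    {f : (A →₀ MvPolynomial V k) →ₗ[MvPolynomial V k] (B →₀ MvPolynomial V k)}
    {g : (B →₀ MvPolynomial V k) →ₗ[MvPolynomial V k] (C →₀ MvPolynomial V k)}
    (hg : GrMap degB degC g) (hf : GrMap degA degB f) : GrMap degA degC (g ∘ₗ f) :=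
  fun a => HomP.map hg (hf a)

/-- the degree `j` component -/
noncomputable def grComp {k V A : Type} [Field k] (deg : A → ℕ) (j : ℕ)
    (x : A →₀ MvPolynomial V k) : A →₀ MvPolynomial V k :=
  Finsupp.onFinset x.support
    (fun a => if deg a ≤ j then homogeneousComponent (j - deg a) (x a) else 0) (by
      intro a ha
      rw [Finsupp.mem_support_iff]
      rintro h0
      simp [h0] at ha)

theorem coeff_grComp {k V A : Type} [Field k] (deg : A → ℕ) (j : ℕ)
    (x : A →₀ MvPolynomial V k) (a : A) (m : V →₀ ℕ) :
    coeff m (grComp deg j x a) = if m.degree + deg a = j then coeff m (x a) else 0 := by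
  unfold grComp
  rw [Finsupp.onFinset_apply]
  by_cases h : deg a ≤ j
  · rw [if_pos h, coeff_homogeneousComponent]
    congr 1
    simp only [eq_iff_iff]
    omega
  · rw [if_neg h, if_neg (by omega), coeff_zero]

theorem exists_graded_preimage {k V B C : Type} [Field k] {degB : B → ℕ} {degC : C → ℕ}
    {δ : (B →₀ MvPolynomial V k) →ₗ[MvPolynomial V k] (C →₀ MvPolynomial V k)}
    (hδ : GrMap degB degC δ) {j : ℕ} (y : B →₀ MvPolynomial V k)
    (h : HomP degC (fun i => i = j) (δ y)) :
    ∃ y', HomP degB (fun i => i = j) y' ∧ δ y' = δ y := by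
  refine ⟨grComp degB j y, ?_, ?_⟩
  · intro a m hm
    rw [coeff_grComp] at hm
    by_contra hc
    exact hm (if_neg hc)
  · have h1 : HomP degB (fun i => i = j) (grComp degB j y) := by
      intro a m hm
      rw [coeff_grComp] at hm
      by_contra hc
      exact hm (if_neg hc)
    have h2 : HomP degB (fun i => i ≠ j) (grComp degB j y - y) := by
      intro a m hm hc
      rw [Finsupp.sub_apply, coeff_sub, coeff_grComp, if_pos hc, sub_self] at hm
      exact hm rfl
    have h1' := h1.map hδ
    have h2' := h2.map hδ
    ext b m
    by_contra hne
    have h3 := h2' b m (by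
      rw [map_sub, Finsupp.sub_apply, coeff_sub]
      exact sub_ne_zero.mpr hne)
    by_cases h4 : coeff m (δ y b) = 0
    · exact h3 (h1' b m (by rw [h4] at hne; exact hne))
    · exact h3 (h b m h4)

theorem exists_graded_lift {k V A B C : Type} [Field k]
    {degA : A → ℕ} {degB : B → ℕ} {degC : C → ℕ}
    {δ : (B →₀ MvPolynomial V k) →ₗ[MvPolynomial V k] (C →₀ MvPolynomial V k)}
    (hδ : GrMap degB degC δ)
    {f : (A →₀ MvPolynomial V k) →ₗ[MvPolynomial V k] (C →₀ MvPolynomial V k)}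
    (hf : GrMap degA degC f) (h : ∀ x, f x ∈ LinearMap.range δ) :
    ∃ g : (A →₀ MvPolynomial V k) →ₗ[MvPolynomial V k] (B →₀ MvPolynomial V k),
      GrMap degA degB g ∧ ∀ x, δ (g x) = f x := by
  have key : ∀ a, ∃ y', HomP degB (fun i => i = degA a) y' ∧
      δ y' = f (Finsupp.single a 1) := by
    intro a
    obtain ⟨y, hy⟩ := h (Finsupp.single a 1)
    obtain ⟨y', h1, h2⟩ := exists_graded_preimage hδ (j := degA a) y (by rw [hy]; exact hf a)
    exact ⟨y', h1, h2.trans hy⟩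
  choose y hy1 hy2 using key
  refine ⟨Finsupp.linearCombination _ y, ?_, ?_⟩
  · intro a
    rw [Finsupp.linearCombination_single, one_smul]
    exact hy1 a
  · intro x
    have : δ ∘ₗ Finsupp.linearCombination _ y = f := by
      refine Finsupp.lhom_ext' fun a => LinearMap.ext_ring ?_
      simp [hy2]
    exact LinearMap.congr_fun this x

theorem exists_lift_s4 {k V A B C : Type} [Field k]
    {δ : (B →₀ MvPolynomial V k) →ₗ[MvPolynomial V k] (C →₀ MvPolynomial V k)}
    {f : (A →₀ MvPolynomial V k) →ₗ[MvPolynomial V k] (C →₀ MvPolynomial V k)}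
    (h : ∀ x, f x ∈ LinearMap.range δ) :
    ∃ g : (A →₀ MvPolynomial V k) →ₗ[MvPolynomial V k] (B →₀ MvPolynomial V k),
      ∀ x, δ (g x) = f x := by
  choose y hy using fun a => h (Finsupp.single a 1)
  refine ⟨Finsupp.linearCombination _ y, fun x => ?_⟩
  have : δ ∘ₗ Finsupp.linearCombination _ y = f := by
    refine Finsupp.lhom_ext' fun a => LinearMap.ext_ring ?_
    simp [hy]
  exact LinearMap.congr_fun this x

/-- minimal graded free resolutions with arbitrary index types for the bases -/
structure MinRes (k V : Type) [Field k] (I : Ideal (MvPolynomial V k)) where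
  ι : ℕ → Type
  deg : ∀ i, ι i → ℕ
  d : ∀ i : ℕ, (ι (i + 1) →₀ MvPolynomial V k) →ₗ[MvPolynomial V k] (ι i →₀ MvPolynomial V k)
  base : ι 0
  base_unique : ∀ a : ι 0, a = base
  deg_base : deg 0 base = 0
  range_zero : ∀ x, x ∈ LinearMap.range (d 0) ↔ x base ∈ I
  exact_succ : ∀ i, LinearMap.ker (d i) = LinearMap.range (d (i + 1))
  minimal : ∀ i x p, constantCoeff ((d i x) p) = 0
  graded : ∀ i, GrMap (deg (i + 1)) (deg i) (d i)

theorem constantCoeff_map {k V A B : Type} [Field k]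
    (f : (A →₀ MvPolynomial V k) →ₗ[MvPolynomial V k] (B →₀ MvPolynomial V k))
    (x : A →₀ MvPolynomial V k) (hx : ∀ a, constantCoeff (x a) = 0) (b : B) :
    constantCoeff (f x b) = 0 := by
  rw [map_apply_eq_sum, map_sum]
  refine Finset.sum_eq_zero fun a _ => ?_
  rw [map_mul, hx a, zero_mul]

theorem MinRes.compare {k V : Type} [Field k] {I : Ideal (MvPolynomial V k)}
    (X Y : MinRes k V I) (i : ℕ) :
    ∃ (φ : (X.ι i →₀ MvPolynomial V k) →ₗ[MvPolynomial V k] (Y.ι i →₀ MvPolynomial V k))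
      (ψ : (Y.ι i →₀ MvPolynomial V k) →ₗ[MvPolynomial V k] (X.ι i →₀ MvPolynomial V k))
      (h : (X.ι i →₀ MvPolynomial V k) →ₗ[MvPolynomial V k] (X.ι (i + 1) →₀ MvPolynomial V k)),
      GrMap (X.deg i) (Y.deg i) φ ∧ GrMap (Y.deg i) (X.deg i) ψ ∧
      (∀ x ∈ LinearMap.range (X.d i), φ x ∈ LinearMap.range (Y.d i)) ∧
      (∀ x ∈ LinearMap.range (Y.d i), ψ x ∈ LinearMap.range (X.d i)) ∧
      (∀ x, ψ (φ (X.d i x)) - X.d i x - X.d i (h (X.d i x)) = 0) ∧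
      (∀ x a, constantCoeff ((ψ (φ x) - x) a) = 0) := by
  induction i with
  | zero =>
    let bc : ∀ (Z W : MinRes k V I), (Z.ι 0 →₀ MvPolynomial V k) →ₗ[MvPolynomial V k]
        (W.ι 0 →₀ MvPolynomial V k) := fun Z W =>
      Finsupp.linearCombination _ (fun _ => Finsupp.single W.base 1)
    have hs : ∀ Z : MinRes k V I, ∀ x : Z.ι 0 →₀ MvPolynomial V k, x = Finsupp.single Z.base (x Z.base) := by
      intro Z x
      ext a
      rw [Z.base_unique a, Finsupp.single_eq_same]
    have hbc : ∀ Z W x, bc Z W x = Finsupp.single W.base (x Z.base) := by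
      intro Z W x
      conv_lhs => rw [hs Z x]
      simp [bc]
    have hgr : ∀ Z W, GrMap (Z.deg 0) (W.deg 0) (bc Z W) := by
      intro Z W a b m hm
      classical
      rw [hbc, Z.base_unique a, W.base_unique b, Finsupp.single_eq_same, Finsupp.single_eq_same,
        coeff_one] at hm
      have : m = 0 := by
        by_contra hc
        exact hm (if_neg (Ne.symm hc))
      rw [Z.base_unique a, W.base_unique b, this, Z.deg_base, W.deg_base]
      simp
    have hrg : ∀ Z W : MinRes k V I, ∀ x ∈ LinearMap.range (Z.d 0),
        bc Z W x ∈ LinearMap.range (W.d 0) := by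
      intro Z W x hx
      rw [W.range_zero, hbc, Finsupp.single_eq_same]
      exact (Z.range_zero x).1 hx
    have hid : ∀ x, bc Y X (bc X Y x) = x := by
      intro x
      rw [hbc, hbc, Finsupp.single_eq_same]
      exact (hs X x).symm
    refine ⟨bc X Y, bc Y X, 0, hgr _ _, hgr _ _, hrg _ _, hrg _ _, ?_, ?_⟩
    · intro x
      rw [hid]; simp
    · intro x a
      rw [hid]; simp
  | succ i ih =>
    obtain ⟨φ, ψ, h, hφ, hψ, hφr, hψr, hh, -⟩ := ih
    obtain ⟨φ', hφ', hφc⟩ := exists_graded_lift (Y.graded i)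
      (hφ.comp (X.graded i)) (fun x => hφr _ ⟨x, rfl⟩)
    obtain ⟨ψ', hψ', hψc⟩ := exists_graded_lift (X.graded i)
      (hψ.comp (Y.graded i)) (fun x => hψr _ ⟨x, rfl⟩)
    simp only [LinearMap.comp_apply] at hφc hψc
    obtain ⟨h', hh'⟩ := exists_lift_s4 (δ := X.d (i + 1))
      (f := ψ' ∘ₗ φ' - LinearMap.id - h ∘ₗ X.d i) (by
        intro x
        rw [← X.exact_succ, LinearMap.mem_ker]
        simp only [LinearMap.sub_apply, LinearMap.comp_apply, LinearMap.id_apply, map_sub]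
        rw [hψc, hφc]
        exact hh x)
    simp only [LinearMap.sub_apply, LinearMap.comp_apply, LinearMap.id_apply] at hh'
    refine ⟨φ', ψ', h', hφ', hψ', ?_, ?_, ?_, ?_⟩
    · intro x hx
      rw [← X.exact_succ, LinearMap.mem_ker] at hx
      rw [← Y.exact_succ, LinearMap.mem_ker, hφc, hx, map_zero]
    · intro x hx
      rw [← Y.exact_succ, LinearMap.mem_ker] at hx
      rw [← X.exact_succ, LinearMap.mem_ker, hψc, hx, map_zero]
    · intro x
      have hx : X.d i (X.d (i + 1) x) = 0 := by
        rw [← LinearMap.mem_ker, X.exact_succ]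
        exact ⟨x, rfl⟩
      rw [hh', hx, map_zero]
      simp
    · intro x a
      have : ψ' (φ' x) - x = X.d (i + 1) (h' x) + h (X.d i x) := by
        rw [hh']; abel
      rw [this, Finsupp.add_apply, map_add, X.minimal, zero_add]
      exact constantCoeff_map h _ (X.minimal i x) a

theorem MinRes.card_le {k V : Type} [Field k] {I : Ideal (MvPolynomial V k)}
    (X Y : MinRes k V I) (i j : ℕ) [Fintype {a : X.ι i // X.deg i a = j}]
    [Fintype {a : Y.ι i // Y.deg i a = j}] :
    Fintype.card {a : X.ι i // X.deg i a = j} ≤ Fintype.card {a : Y.ι i // Y.deg i a = j} := by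
  classical
  obtain ⟨φ, ψ, -, hφ, -, -, -, -, hc⟩ := X.compare Y i
  let emb : ({a : X.ι i // X.deg i a = j} → k) → (X.ι i →₀ MvPolynomial V k) := fun u =>
    ∑ a, Finsupp.single a.1 (C (u a))
  have emb_apply : ∀ u (a : {a : X.ι i // X.deg i a = j}), emb u a.1 = C (u a) := by
    intro u a
    simp only [emb, Finsupp.finsetSum_apply]
    rw [Finset.sum_eq_single a]
    · simp
    · intro b _ hb
      rw [Finsupp.single_apply, if_neg]
      exact fun h => hb (Subtype.ext h)
    · simp
  have emb_hom : ∀ u, HomP (X.deg i) (fun l => l = j) (emb u) := by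
    intro u a m hm
    by_cases ha : X.deg i a = j
    · have := emb_apply u ⟨a, ha⟩
      simp only at this
      rw [this, coeff_C] at hm
      have : m = 0 := by
        by_contra hc
        exact hm (if_neg (Ne.symm hc))
      rw [this]; simpa using ha
    · exfalso
      apply hm
      simp only [emb, Finsupp.finsetSum_apply]
      rw [Finset.sum_eq_zero, coeff_zero]
      intro b _
      rw [Finsupp.single_apply, if_neg]
      intro h
      exact ha (h ▸ b.2)
  let L : ({a : X.ι i // X.deg i a = j} → k) →ₗ[k] ({a : Y.ι i // Y.deg i a = j} → k) :=
    { toFun := fun u c => constantCoeff (φ (emb u) c.1)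
      map_add' := by
        intro u v
        have : emb (u + v) = emb u + emb v := by
          simp [emb, Finset.sum_add_distrib]
        ext c
        simp [this]
      map_smul' := by
        intro t u
        have : emb (t • u) = (C t : MvPolynomial V k) • emb u := by
          simp [emb, Finset.smul_sum]
        ext c
        simp [this] }
  refine card_le_of_injective k L ?_
  rw [← LinearMap.ker_eq_bot, LinearMap.ker_eq_bot']
  intro u hu
  have h1 : ∀ c, constantCoeff (φ (emb u) c) = 0 := by
    intro c
    by_cases hcj : Y.deg i c = j
    · exact congrFun hu ⟨c, hcj⟩
    · by_contra hne
      rw [constantCoeff_eq] at hne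
      have := (emb_hom u).map hφ c 0 hne
      simp at this
      exact hcj this
  have h2 := constantCoeff_map ψ _ h1
  ext a
  have h3 := hc (emb u) a.1
  rw [Finsupp.sub_apply, map_sub, h2, emb_apply] at h3
  simpa using h3

/-- The given resolutions as instances of `MinRes`. -/
noncomputable def MinimalGradedFreeResolution.toMinRes {k V : Type} [Field k] [Fintype V]
    [DecidableEq V] {I : Ideal (MvPolynomial V k)} (F : MinimalGradedFreeResolution k V I) :
    MinRes k V I where
  ι i := Σ j : ℕ, Fin (F.β i j)
  deg i a := a.1
  d := F.d
  base := ⟨0, ⟨0, by rw [F.β_zero]; simp⟩⟩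
  base_unique := by
    rintro ⟨j, t, ht⟩
    have h := F.β_zero j
    by_cases hj : j = 0
    · subst hj
      rw [if_pos rfl] at h
      congr
      omega
    · rw [if_neg hj] at h
      omega
  deg_base := rfl
  range_zero := by
    intro x
    set b : Σ j : ℕ, Fin (F.β 0 j) := ⟨0, ⟨0, by rw [F.β_zero]; simp⟩⟩ with hb
    have hu : ∀ a : Σ j : ℕ, Fin (F.β 0 j), a = b := by
      rintro ⟨j, t, ht⟩
      have h := F.β_zero j
      by_cases hj : j = 0
      · subst hj
        rw [if_pos rfl] at h
        rw [hb]
        congr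
        omega
      · rw [if_neg hj] at h
        omega
    have hs : ∀ x : (Σ j : ℕ, Fin (F.β 0 j)) →₀ MvPolynomial V k,
        x = x b • Finsupp.single b 1 := by
      intro x
      ext a
      rw [hu a]
      simp
    have haug : ∀ x, F.aug x = Ideal.Quotient.mk I (x b) * F.aug (Finsupp.single b 1) := by
      intro x
      conv_lhs => rw [hs x, map_smul]
      obtain ⟨q, hq⟩ := Ideal.Quotient.mk_surjective (F.aug (Finsupp.single b 1))
      rw [← hq]
      rfl
    rw [← F.exact_zero, LinearMap.mem_ker, ← Ideal.Quotient.eq_zero_iff_mem]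
    obtain ⟨y, hy⟩ := F.aug_surjective 1
    rw [haug] at hy
    rw [haug]
    constructor
    · intro h
      calc _ = Ideal.Quotient.mk I (x b) * 1 := by rw [mul_one]
        _ = (Ideal.Quotient.mk I (x b) * F.aug (Finsupp.single b 1)) *
            Ideal.Quotient.mk I (y b) := by rw [← hy]; ring
        _ = 0 := by rw [h, zero_mul]
    · intro h
      rw [h, zero_mul]
  exact_succ := F.exact_succ
  minimal := F.minimal
  graded := by
    rintro i ⟨j, t⟩ p m hm
    obtain ⟨h1, h2⟩ := F.graded i j t p
    rcases h2 with h2 | h2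
    · have := h1 hm
      simp only
      have hw : Finsupp.weight 1 m = m.degree := by rw [Finsupp.degree_eq_weight_one]; rfl
      omega
    · rw [h2] at hm
      simp at hm

theorem MinimalGradedFreeResolution.β_eq {k V : Type} [Field k] [Fintype V]
    [DecidableEq V] {I : Ideal (MvPolynomial V k)} (F : MinimalGradedFreeResolution k V I)
    (Y : MinRes k V I) (i j : ℕ) [Fintype {a : Y.ι i // Y.deg i a = j}] :
    F.β i j = Fintype.card {a : Y.ι i // Y.deg i a = j} := by
  let e : {a : F.toMinRes.ι i // F.toMinRes.deg i a = j} ≃ Fin (F.β i j) :=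
    { toFun := fun a => Fin.cast (congrArg (F.β i) a.2) a.1.2
      invFun := fun t => ⟨⟨j, t⟩, rfl⟩
      left_inv := by
        rintro ⟨⟨j', t⟩, h⟩
        change j' = j at h
        subst h
        rfl
      right_inv := fun t => rfl }
  let : Fintype {a : F.toMinRes.ι i // F.toMinRes.deg i a = j} := Fintype.ofEquiv _ e.symm
  have h : Fintype.card {a : F.toMinRes.ι i // F.toMinRes.deg i a = j} = F.β i j := by
    rw [Fintype.card_congr e, Fintype.card_fin]
  rw [← h]
  exact le_antisymm (MinRes.card_le _ _ i j) (MinRes.card_le _ _ i j)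

/-! ### The Taylor resolution -/

/-- the exponent vector of a squarefree monomial -/
noncomputable def sqExp {V : Type} (A : Finset V) : V →₀ ℕ :=
  ∑ w ∈ A, Finsupp.single w 1

theorem sqExp_apply {V : Type} [DecidableEq V] (A : Finset V) (w : V) :
    sqExp A w = if w ∈ A then 1 else 0 := by
  simp [sqExp, Finsupp.finsetSum_apply, Finsupp.single_apply]

theorem sqExp_le {V : Type} [DecidableEq V] (A : Finset V) (μ : V →₀ ℕ) :
    sqExp A ≤ μ ↔ ∀ a ∈ A, 1 ≤ μ a := by
  rw [Finsupp.le_def]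
  constructor
  · intro h a ha
    have := h a
    rwa [sqExp_apply, if_pos ha] at this
  · intro h a
    rw [sqExp_apply]
    split_ifs with ha
    · exact h a ha
    · exact Nat.zero_le _

theorem sqExp_degree {V : Type} (A : Finset V) : (sqExp A).degree = A.card := by
  simp [sqExp]

/-- the union of the edges in `T` -/
def unionE {V : Type} [DecidableEq V] {n : ℕ} (E : Fin n → Finset V) (T : Finset (Fin n)) :
    Finset V := T.biUnion E

theorem unionE_insert {V : Type} [DecidableEq V] {n : ℕ} (E : Fin n → Finset V)
    (v : Fin n) (T : Finset (Fin n)) : unionE E (insert v T) = E v ∪ unionE E T := by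
  simp [unionE]

theorem sqExp_unionE_insert {V : Type} [DecidableEq V] {n : ℕ} (E : Fin n → Finset V)
    (v : Fin n) (T : Finset (Fin n)) :
    sqExp (unionE E (insert v T)) = sqExp (unionE E T) + sqExp (E v \ unionE E T) := by
  ext w
  rw [unionE_insert, Finsupp.add_apply, sqExp_apply, sqExp_apply, sqExp_apply]
  simp only [Finset.mem_union, Finset.mem_sdiff]
  by_cases h1 : w ∈ E v <;> by_cases h2 : w ∈ unionE E T <;> simp [h1, h2]

theorem sqExp_unionE_le {V : Type} [DecidableEq V] {n : ℕ} (E : Fin n → Finset V)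
    (T : Finset (Fin n)) (μ : V →₀ ℕ) :
    sqExp (unionE E T) ≤ μ ↔ ∀ v ∈ T, sqExp (E v) ≤ μ := by
  simp only [sqExp_le, unionE, Finset.mem_biUnion]
  constructor
  · intro h v hv a ha
    exact h a ⟨v, hv, ha⟩
  · rintro h a ⟨v, hv, ha⟩
    exact h v hv a ha

/-- the sign in the simplicial boundary map -/
def tSign (k : Type) [Field k] {n : ℕ} (v : Fin n) (T : Finset (Fin n)) : k :=
  (-1) ^ (T.filter (· < v)).card

theorem tSign_insert {k : Type} [Field k] {n : ℕ} (v w : Fin n) (T : Finset (Fin n))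
    (hw : w ∉ T) : tSign k v (insert w T) = (if w < v then -1 else 1) * tSign k v T := by
  unfold tSign
  rw [Finset.filter_insert]
  split_ifs with h
  · rw [Finset.card_insert_of_notMem (by simp [hw]), pow_succ]
    ring
  · rw [one_mul]

theorem tSign_sq {k : Type} [Field k] {n : ℕ} (v : Fin n) (T : Finset (Fin n)) :
    tSign k v T * tSign k v T = 1 := by
  unfold tSign
  rw [← mul_pow]; simp

theorem tSign_skew {k : Type} [Field k] {n : ℕ} (v w : Fin n) (T : Finset (Fin n))
    (hv : v ∉ T) (hw : w ∉ T) (hvw : v ≠ w) :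
    tSign k v (insert w T) * tSign k w (insert v T) = - (tSign k v T * tSign k w T) := by
  rw [tSign_insert _ _ _ hv, tSign_insert _ _ _ hw]
  rcases lt_or_gt_of_ne hvw with h | h
  · rw [if_neg (not_lt.2 h.le), if_pos h]; ring
  · rw [if_pos h, if_neg (not_lt.2 h.le)]; ring

theorem tSign_skew' {k : Type} [Field k] {n : ℕ} (v w : Fin n) (T : Finset (Fin n))
    (hv : v ∉ T) (hw : w ∉ T) (hvw : v ≠ w) :
    tSign k v T * tSign k w (insert v T) + tSign k w T * tSign k v (insert w T) = 0 := by
  rw [tSign_insert _ _ _ hv, tSign_insert _ _ _ hw]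
  rcases lt_or_gt_of_ne hvw with h | h
  · rw [if_neg (not_lt.2 h.le), if_pos h]; ring
  · rw [if_pos h, if_neg (not_lt.2 h.le)]; ring

/-- the total Taylor differential -/
noncomputable def taylorD (k : Type) [Field k] {V : Type} [DecidableEq V] {n : ℕ}
    (E : Fin n → Finset V) :
    (Finset (Fin n) → MvPolynomial V k) →ₗ[MvPolynomial V k]
      (Finset (Fin n) → MvPolynomial V k) where
  toFun X T := ∑ v ∈ Tᶜ, monomial (sqExp (E v \ unionE E T)) (tSign k v T) * X (insert v T)
  map_add' X Y := by
    ext1 T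
    simp [mul_add, Finset.sum_add_distrib]
  map_smul' c X := by
    ext1 T
    simp only [Pi.smul_apply, smul_eq_mul, RingHom.id_apply, Finset.mul_sum]
    exact Finset.sum_congr rfl fun v _ => by ring

theorem taylorD_apply {k : Type} [Field k] {V : Type} [DecidableEq V] {n : ℕ}
    (E : Fin n → Finset V) (X : Finset (Fin n) → MvPolynomial V k) (T : Finset (Fin n)) :
    taylorD k E X T =
      ∑ v ∈ Tᶜ, monomial (sqExp (E v \ unionE E T)) (tSign k v T) * X (insert v T) := rfl

/-- coefficients normalized by multidegree -/
noncomputable def nrm {k : Type} [Field k] {V : Type} [DecidableEq V] {n : ℕ}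
    (E : Fin n → Finset V) (X : Finset (Fin n) → MvPolynomial V k) (T : Finset (Fin n))
    (μ : V →₀ ℕ) : k :=
  open Classical in
  if sqExp (unionE E T) ≤ μ then coeff (μ - sqExp (unionE E T)) (X T) else 0

theorem nrm_inj {k : Type} [Field k] {V : Type} [DecidableEq V] {n : ℕ}
    (E : Fin n → Finset V) (X Y : Finset (Fin n) → MvPolynomial V k)
    (h : ∀ T μ, nrm E X T μ = nrm E Y T μ) : X = Y := by
  ext T m
  have := h T (m + sqExp (unionE E T))
  unfold nrm at this
  rwa [if_pos le_add_self, if_pos le_add_self, add_tsub_cancel_right] at this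

theorem nrm_taylorD {k : Type} [Field k] {V : Type} [DecidableEq V] {n : ℕ}
    (E : Fin n → Finset V) (X : Finset (Fin n) → MvPolynomial V k) (T : Finset (Fin n))
    (μ : V →₀ ℕ) :
    nrm E (taylorD k E X) T μ = ∑ v ∈ Tᶜ, tSign k v T * nrm E X (insert v T) μ := by
  classical
  unfold nrm
  split_ifs with h
  · rw [taylorD_apply, coeff_sum]
    refine Finset.sum_congr rfl fun v _ => ?_
    rw [coeff_monomial_mul', sqExp_unionE_insert]
    have : sqExp (E v \ unionE E T) ≤ μ - sqExp (unionE E T) ↔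
        sqExp (unionE E T) + sqExp (E v \ unionE E T) ≤ μ := by
      rw [le_tsub_iff_left h]
    by_cases h2 : sqExp (unionE E T) + sqExp (E v \ unionE E T) ≤ μ
    · rw [if_pos h2, if_pos (this.2 h2), tsub_tsub]
    · rw [if_neg h2, if_neg (fun hc => h2 (this.1 hc)), mul_zero]
  · symm
    refine Finset.sum_eq_zero fun v _ => ?_
    rw [if_neg, mul_zero]
    intro hc
    apply h
    refine le_trans ?_ hc
    rw [sqExp_unionE_insert]
    exact le_self_add

theorem nrm_zero {k : Type} [Field k] {V : Type} [DecidableEq V] {n : ℕ}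
    (E : Fin n → Finset V) (T : Finset (Fin n)) (μ : V →₀ ℕ) :
    nrm E (0 : Finset (Fin n) → MvPolynomial V k) T μ = 0 := by
  unfold nrm
  simp

theorem nrm_eq_zero {k : Type} [Field k] {V : Type} [DecidableEq V] {n : ℕ}
    (E : Fin n → Finset V) (X : Finset (Fin n) → MvPolynomial V k) (T : Finset (Fin n))
    (μ : V →₀ ℕ) (v : Fin n) (hv : v ∈ T) (h : ¬ sqExp (E v) ≤ μ) : nrm E X T μ = 0 := by
  unfold nrm
  rw [if_neg]
  rw [sqExp_unionE_le]
  exact fun hc => h (hc v hv)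

theorem taylorD_sq {k : Type} [Field k] {V : Type} [DecidableEq V] {n : ℕ}
    (E : Fin n → Finset V) (X : Finset (Fin n) → MvPolynomial V k) :
    taylorD k E (taylorD k E X) = 0 := by
  apply nrm_inj E
  intro T μ
  rw [nrm_zero, nrm_taylorD]
  simp_rw [nrm_taylorD, Finset.mul_sum]
  rw [Finset.sum_sigma']
  refine Finset.sum_involution (fun p _ => ⟨p.2, p.1⟩) ?_ ?_ ?_ ?_
  · rintro ⟨v, w⟩ h
    simp only [Finset.mem_sigma, Finset.mem_compl, Finset.mem_insert, not_or] at h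
    have := tSign_skew' (k := k) v w T h.1 h.2.2 (Ne.symm h.2.1)
    simp only
    rw [Finset.insert_comm v w, ← mul_assoc, ← mul_assoc, ← add_mul, this, zero_mul]
  · rintro ⟨v, w⟩ h _
    simp only [Finset.mem_sigma, Finset.mem_compl, Finset.mem_insert, not_or] at h
    intro hc
    simp only [Sigma.mk.injEq] at hc
    exact h.2.1 hc.1
  · rintro ⟨v, w⟩ h
    simp only [Finset.mem_sigma, Finset.mem_compl, Finset.mem_insert, not_or] at h ⊢
    exact ⟨h.2.2, Ne.symm h.2.1, h.1⟩
  · rintro ⟨v, w⟩ h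
    rfl

theorem exists_poly {k : Type} [Field k] {V : Type} (g : (V →₀ ℕ) → k)
    (hg : {m | g m ≠ 0}.Finite) : ∃ p : MvPolynomial V k, ∀ m, coeff m p = g m := by
  classical
  refine ⟨∑ m ∈ hg.toFinset, monomial m (g m), fun m => ?_⟩
  rw [coeff_sum]
  simp only [coeff_monomial, Finset.sum_ite_eq', Set.Finite.mem_toFinset, Set.mem_ofPred_eq]
  split_ifs with h
  · rfl
  · exact (not_not.1 h).symm

theorem taylorD_exact {k : Type} [Field k] {V : Type} [DecidableEq V] {n : ℕ}
    (E : Fin n → Finset V) (X : Finset (Fin n) → MvPolynomial V k)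
    (h0 : X ∅ = 0) (hX : taylorD k E X = 0) :
    ∃ Y, taylorD k E Y = X ∧ ∀ T, (∀ w ∈ T, X (T.erase w) = 0) → Y T = 0 := by
  classical
  rcases isEmpty_or_nonempty (Fin n) with hn | hn
  · refine ⟨0, ?_, fun _ _ => rfl⟩
    ext1 T
    rw [Subsingleton.elim T ∅, h0, map_zero]
    rfl
  have hw0 : ∀ μ : V →₀ ℕ, ∃ w : Fin n, ∀ v, sqExp (E v) ≤ μ → sqExp (E w) ≤ μ := by
    intro μ
    by_cases h : ∃ v, sqExp (E v) ≤ μ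
    · obtain ⟨v, hv⟩ := h
      exact ⟨v, fun _ _ => hv⟩
    · push Not at h
      exact ⟨Classical.arbitrary _, fun v hv => absurd hv (h v)⟩
  choose w0 hw0 using hw0
  let g : Finset (Fin n) → (V →₀ ℕ) → k := fun T μ =>
    if w0 μ ∈ T then tSign k (w0 μ) (T.erase (w0 μ)) * nrm E X (T.erase (w0 μ)) μ else 0
  have hgfin : ∀ T, {m | g T (m + sqExp (unionE E T)) ≠ 0}.Finite := by
    intro T
    have hsub : {m | g T (m + sqExp (unionE E T)) ≠ 0} ⊆
        ⋃ w ∈ T, (fun m => m + sqExp (E w \ unionE E (T.erase w))) ⁻¹'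
          (X (T.erase w)).support := by
      intro m hm
      simp only [Set.mem_ofPred_eq, g] at hm
      by_cases hw : w0 (m + sqExp (unionE E T)) ∈ T
      · rw [if_pos hw] at hm
        generalize w0 (m + sqExp (unionE E T)) = w at hw hm
        simp only [Set.mem_iUnion]
        refine ⟨w, hw, ?_⟩
        have h1 := right_ne_zero_of_mul hm
        have h2 : sqExp (unionE E T) = sqExp (unionE E (T.erase w)) +
            sqExp (E w \ unionE E (T.erase w)) := by
          rw [← sqExp_unionE_insert, Finset.insert_erase hw]
        rw [h2] at h1
        unfold nrm at h1
        rw [if_pos (le_add_left le_self_add), add_left_comm, add_tsub_cancel_left] at h1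
        simpa [mem_support_iff] using h1
      · exact absurd (if_neg hw) hm
    refine Set.Finite.subset ?_ hsub
    refine Set.Finite.biUnion T.finite_toSet fun w _ => ?_
    exact Set.Finite.preimage (fun a _ b _ hab => add_right_cancel hab) (Finset.finite_toSet _)
  choose Y hY using fun T => exists_poly _ (hgfin T)
  have hnY : ∀ T μ, sqExp (E (w0 μ)) ≤ μ → nrm E Y T μ = g T μ := by
    intro T μ hμ
    unfold nrm
    split_ifs with h
    · rw [hY, tsub_add_cancel_of_le h]
    · simp only [g]
      split_ifs with hw
      · rw [nrm, if_neg, mul_zero]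
        intro hc
        apply h
        rw [sqExp_unionE_le] at hc ⊢
        intro v hv
        by_cases hvw : v = w0 μ
        · rw [hvw]; exact hμ
        · exact hc v (Finset.mem_erase.2 ⟨hvw, hv⟩)
      · rfl
  refine ⟨Y, ?_, ?_⟩
  · apply nrm_inj E
    intro T μ
    rw [nrm_taylorD]
    by_cases hμ : sqExp (E (w0 μ)) ≤ μ
    · simp_rw [fun T => hnY T μ hμ, g]
      generalize w0 μ = w
      by_cases hw : w ∈ T
      · have hT : insert w (T.erase w) = T := Finset.insert_erase hw
        have hwT' : w ∉ T.erase w := Finset.notMem_erase _ _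
        generalize T.erase w = T' at hT hwT'
        subst hT
        have hD : nrm E (taylorD k E X) T' μ = 0 := by rw [hX, nrm_zero]
        rw [nrm_taylorD] at hD
        have hcompl : T'ᶜ = insert w (insert w T')ᶜ := by
          ext v
          by_cases hv : v = w
          · subst hv; simp [hwT']
          · simp [hv]
        rw [hcompl, Finset.sum_insert (by simp)] at hD
        have hterm : ∀ v ∈ (insert w T')ᶜ,
            tSign k v (insert w T') * (if w ∈ insert v (insert w T') then
              tSign k w ((insert v (insert w T')).erase w) *
                nrm E X ((insert v (insert w T')).erase w) μ else 0) =
            - tSign k w T' * (tSign k v T' * nrm E X (insert v T') μ) := by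
          intro v hv
          simp only [Finset.mem_compl, Finset.mem_insert, not_or] at hv
          have he : (insert v (insert w T')).erase w = insert v T' := by
            rw [Finset.insert_comm, Finset.erase_insert]
            simp [hwT', Ne.symm hv.1]
          rw [if_pos (by simp), he, ← mul_assoc, tSign_skew v w T' hv.2 hwT' hv.1]
          ring
        rw [Finset.sum_congr rfl hterm, ← Finset.mul_sum, eq_neg_of_add_eq_zero_right hD]
        have := tSign_sq (k := k) w T'
        linear_combination (nrm E X (insert w T') μ) * this
      · rw [Finset.sum_eq_single w]
        · rw [if_pos (Finset.mem_insert_self _ _), Finset.erase_insert hw, ← mul_assoc, tSign_sq,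
            one_mul]
        · intro v _ hvw
          rw [if_neg, mul_zero]
          simp [hw, Ne.symm hvw]
        · intro hc
          exact absurd (Finset.mem_compl.2 hw) hc
    · have hall : ∀ v, ¬ sqExp (E v) ≤ μ := fun v hv => hμ (hw0 μ v hv)
      rw [Finset.sum_eq_zero]
      · rcases T.eq_empty_or_nonempty with rfl | ⟨v, hv⟩
        · unfold nrm
          rw [h0]; simp
        · exact (nrm_eq_zero E X T μ v hv (hall v)).symm
      · intro v _
        rw [nrm_eq_zero E Y _ μ v (Finset.mem_insert_self _ _) (hall v), mul_zero]
  · intro T hT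
    ext m
    rw [hY, coeff_zero]
    simp only [g]
    split_ifs with hw
    · unfold nrm
      rw [hT _ hw]; simp
    · rfl

/-- extension by zero -/
noncomputable def tExt (k V : Type) [Field k] (n i : ℕ) :
    ({S : Finset (Fin n) // S.card = i} →₀ MvPolynomial V k) →ₗ[MvPolynomial V k]
      (Finset (Fin n) → MvPolynomial V k) where
  toFun x S := if h : S.card = i then x ⟨S, h⟩ else 0
  map_add' x y := by
    ext1 S
    by_cases h : S.card = i <;> simp [h]
  map_smul' c x := by
    ext1 S
    by_cases h : S.card = i <;> simp [h]

/-- restriction -/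
noncomputable def tRes (k V : Type) [Field k] (n i : ℕ) :
    (Finset (Fin n) → MvPolynomial V k) →ₗ[MvPolynomial V k]
      ({S : Finset (Fin n) // S.card = i} →₀ MvPolynomial V k) :=
  (Finsupp.linearEquivFunOnFinite (MvPolynomial V k) (MvPolynomial V k) _).symm.toLinearMap ∘ₗ
    LinearMap.funLeft (MvPolynomial V k) (MvPolynomial V k) Subtype.val

theorem tRes_apply {k V : Type} [Field k] {n i : ℕ} (X : Finset (Fin n) → MvPolynomial V k)
    (S : {S : Finset (Fin n) // S.card = i}) : tRes k V n i X S = X S.1 := rfl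

theorem tExt_pos {k V : Type} [Field k] {n i : ℕ}
    (x : {S : Finset (Fin n) // S.card = i} →₀ MvPolynomial V k)
    (S : Finset (Fin n)) (h : S.card = i) : tExt k V n i x S = x ⟨S, h⟩ := dif_pos h

theorem tExt_neg {k V : Type} [Field k] {n i : ℕ}
    (x : {S : Finset (Fin n) // S.card = i} →₀ MvPolynomial V k)
    (S : Finset (Fin n)) (h : S.card ≠ i) : tExt k V n i x S = 0 := dif_neg h

theorem tRes_tExt {k V : Type} [Field k] {n i : ℕ}
    (x : {S : Finset (Fin n) // S.card = i} →₀ MvPolynomial V k) :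
    tRes k V n i (tExt k V n i x) = x := by
  ext1 S
  rw [tRes_apply, tExt_pos x S.1 S.2]

theorem tExt_tRes {k V : Type} [Field k] {n i : ℕ} (X : Finset (Fin n) → MvPolynomial V k)
    (h : ∀ S, S.card ≠ i → X S = 0) : tExt k V n i (tRes k V n i X) = X := by
  ext1 S
  by_cases hS : S.card = i
  · rw [tExt_pos _ S hS, tRes_apply]
  · rw [tExt_neg _ S hS, h S hS]

theorem tExt_taylor {k V : Type} [Field k] [DecidableEq V] {n i : ℕ} (E : Fin n → Finset V)
    (x : {S : Finset (Fin n) // S.card = i + 1} →₀ MvPolynomial V k) :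
    tExt k V n i (tRes k V n i (taylorD k E (tExt k V n (i + 1) x))) =
      taylorD k E (tExt k V n (i + 1) x) := by
  apply tExt_tRes
  intro S hS
  rw [taylorD_apply]
  refine Finset.sum_eq_zero fun v hv => ?_
  rw [tExt_neg, mul_zero]
  rw [Finset.card_insert_of_notMem (Finset.mem_compl.1 hv)]
  omega

/-- the Taylor resolution, which is minimal when every edge has a private vertex -/
noncomputable def taylorRes (k V : Type) [Field k] [Fintype V] [DecidableEq V] {n : ℕ}
    (E : Fin n → Finset V)
    (hp : ∀ v T, v ∉ T → (E v \ unionE E T).Nonempty) : MinRes k V (edgeIdeal k E) where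
  ι i := {S : Finset (Fin n) // S.card = i}
  deg i S := (unionE E S.1).card
  d i := tRes k V n i ∘ₗ taylorD k E ∘ₗ tExt k V n (i + 1)
  base := ⟨∅, rfl⟩
  base_unique := by
    rintro ⟨S, hS⟩
    exact Subtype.ext (Finset.card_eq_zero.1 hS)
  deg_base := by simp [unionE]
  range_zero := by
    have hD : ∀ X : Finset (Fin n) → MvPolynomial V k, taylorD k E X ∅ =
        ∑ v, X {v} * ∏ w ∈ E v, (MvPolynomial.X w : MvPolynomial V k) := by
      intro X
      rw [taylorD_apply, Finset.compl_empty]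
      refine Finset.sum_congr rfl fun v _ => ?_
      rw [mul_comm]
      congr 1
      simp only [unionE, Finset.biUnion_empty, Finset.sdiff_empty, sqExp, tSign,
        Finset.filter_empty, Finset.card_empty, pow_zero]
      rw [monomial_sum_one]
      rfl
    intro x
    unfold edgeIdeal
    rw [Ideal.mem_span_range_iff_exists_fun]
    constructor
    · rintro ⟨y, rfl⟩
      refine ⟨fun v => tExt k V n 1 y {v}, ?_⟩
      exact (hD _).symm
    · rintro ⟨c, hc⟩
      refine ⟨tRes k V n 1 (fun S => ∑ v ∈ S, c v), ?_⟩
      ext1 S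
      have hS : S = ⟨∅, rfl⟩ := Subtype.ext (Finset.card_eq_zero.1 S.2)
      rw [hS, ← hc, LinearMap.comp_apply, tRes_apply, LinearMap.comp_apply, hD]
      refine Finset.sum_congr rfl fun v _ => ?_
      congr 1
      rw [tExt_pos _ {v} (by simp), tRes_apply]
      simp
  exact_succ := by
    intro i
    ext x
    rw [LinearMap.mem_ker]
    simp only [LinearMap.comp_apply, LinearMap.mem_range]
    constructor
    · intro hx
      have h1 : taylorD k E (tExt k V n (i + 1) x) = 0 := by
        rw [← tExt_taylor, hx, map_zero]
      obtain ⟨Y, hY1, hY2⟩ := taylorD_exact E (tExt k V n (i + 1) x)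
        (tExt_neg _ _ (by simp)) h1
      refine ⟨tRes k V n (i + 1 + 1) Y, ?_⟩
      rw [tExt_tRes, hY1, tRes_tExt]
      intro S hS
      apply hY2
      intro w hw
      apply tExt_neg
      rw [Finset.card_erase_of_mem hw]
      have := Finset.card_pos.2 ⟨w, hw⟩
      omega
    · rintro ⟨y, rfl⟩
      rw [tExt_taylor, taylorD_sq, map_zero]
  minimal := by
    intro i x T
    rw [LinearMap.comp_apply, tRes_apply, LinearMap.comp_apply, taylorD_apply, map_sum]
    refine Finset.sum_eq_zero fun v hv => ?_
    rw [map_mul, constantCoeff_monomial, if_neg, zero_mul]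
    obtain ⟨w, hw⟩ := hp v T.1 (Finset.mem_compl.1 hv)
    intro hc
    have := DFunLike.congr_fun hc w
    rw [sqExp_apply, if_pos hw] at this
    simp at this
  graded := by
    intro i S T m hm
    rw [LinearMap.comp_apply, tRes_apply, LinearMap.comp_apply, taylorD_apply, coeff_sum] at hm
    obtain ⟨v, hv, hm⟩ := Finset.exists_ne_zero_of_sum_ne_zero hm
    have hcard : (insert v T.1).card = i + 1 := by
      rw [Finset.card_insert_of_notMem (Finset.mem_compl.1 hv), T.2]
    rw [tExt_pos _ _ hcard] at hm
    by_cases hS : S = ⟨insert v T.1, hcard⟩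
    · rw [hS, Finsupp.single_eq_same, mul_one, coeff_monomial] at hm
      have hm2 : sqExp (E v \ unionE E T.1) = m := by
        by_contra hc
        exact hm (if_neg hc)
      simp only
      rw [← hm2, hS, sqExp_degree, ← sqExp_degree (unionE E T.1),
        ← sqExp_degree (unionE E (insert v T.1)), sqExp_unionE_insert, map_add, sqExp_degree,
        sqExp_degree, add_comm]
    · rw [Finsupp.single_apply, if_neg hS, mul_zero, coeff_zero] at hm
      exact absurd rfl hm

/-! ### Counting -/

/-- the number of maximal runs of consecutive integers -/
def runs (S : Finset ℕ) : ℕ := (S.filter (fun v => v + 1 ∉ S)).card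

theorem runs_insert_adj (S : Finset ℕ) (u : ℕ) (h : ∀ x ∈ S, x < u + 1) (hu : u ∈ S) :
    runs (insert (u + 1) S) = runs S := by
  unfold runs
  have hv : u + 1 ∉ S := fun hc => lt_irrefl _ (h _ hc)
  have h2 : u + 2 ∉ S := fun hc => by have := h _ hc; omega
  have : (insert (u + 1) S).filter (fun v => v + 1 ∉ insert (u + 1) S) =
      insert (u + 1) ((S.filter (fun v => v + 1 ∉ S)).erase u) := by
    ext x
    simp only [Finset.mem_filter, Finset.mem_insert, Finset.mem_erase, not_or]
    constructor
    · rintro ⟨rfl | hx, h3, h4⟩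
      · exact Or.inl rfl
      · exact Or.inr ⟨by omega, hx, h4⟩
    · rintro (rfl | ⟨h3, hx, h4⟩)
      · exact ⟨Or.inl rfl, by omega, h2⟩
      · exact ⟨Or.inr hx, by omega, h4⟩
  have hmem : u ∈ S.filter (fun v => v + 1 ∉ S) := Finset.mem_filter.2 ⟨hu, hv⟩
  rw [this, Finset.card_insert_of_notMem (by simp [hv]), Finset.card_erase_of_mem hmem]
  have := Finset.card_pos.2 ⟨u, hmem⟩
  omega

theorem runs_insert_gap (S : Finset ℕ) (v : ℕ) (h : ∀ x ∈ S, x + 1 < v) :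
    runs (insert v S) = runs S + 1 := by
  unfold runs
  have hv : v ∉ S := fun hc => by have := h _ hc; omega
  have h2 : v + 1 ∉ S := fun hc => by have := h _ hc; omega
  have : (insert v S).filter (fun x => x + 1 ∉ insert v S) =
      insert v (S.filter (fun x => x + 1 ∉ S)) := by
    ext x
    simp only [Finset.mem_filter, Finset.mem_insert, not_or]
    constructor
    · rintro ⟨rfl | hx, h3, h4⟩
      · exact Or.inl rfl
      · exact Or.inr ⟨hx, h4⟩
    · rintro (rfl | ⟨hx, h4⟩)
      · exact ⟨Or.inl rfl, by omega, h2⟩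
      · have := h x hx
        exact ⟨Or.inr hx, by omega, h4⟩
  rw [this, Finset.card_insert_of_notMem (by simp [hv])]

theorem runs_pos (S : Finset ℕ) (h : S.Nonempty) : 1 ≤ runs S := by
  refine Finset.card_pos.2 ⟨S.max' h, Finset.mem_filter.2 ⟨S.max'_mem h, fun hc => ?_⟩⟩
  have := S.le_max' _ hc
  omega

theorem runs_le (S : Finset ℕ) : runs S ≤ S.card := Finset.card_filter_le _ _

theorem card_biUnion_line {V : Type} [DecidableEq V] {n d α : ℕ} {E : ℕ → Finset V}
    (hl : IsLineHypergraph n d α E) (S : Finset ℕ) (hS : ∀ x ∈ S, x < n) :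
    (S.biUnion E).card + α * S.card = S.card * d + α * runs S := by
  induction S using Finset.induction_on_max with
  | empty => simp [runs]
  | insert v S hmax ih =>
    have hvS : v ∉ S := fun hc => lt_irrefl _ (hmax _ hc)
    have hvn : v < n := hS v (Finset.mem_insert_self _ _)
    have ih' := ih (fun x hx => hS x (Finset.mem_insert_of_mem hx))
    rw [Finset.biUnion_insert, Finset.card_insert_of_notMem hvS]
    have hun := Finset.card_union_add_card_inter (E v) (S.biUnion E)
    rw [hl.card_eq v hvn] at hun
    by_cases hadj : ∃ u ∈ S, u + 1 = v
    · obtain ⟨u, hu, rfl⟩ := hadj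
      rw [runs_insert_adj S u hmax hu]
      have : E (u + 1) ∩ S.biUnion E = E u ∩ E (u + 1) := by
        ext w
        simp only [Finset.mem_inter, Finset.mem_biUnion]
        constructor
        · rintro ⟨h1, x, hx, h2⟩
          have hxu := hmax x hx
          have := (hl.inter_nonempty_iff (u + 1) hvn x (by omega) (by omega)).1
            ⟨w, Finset.mem_inter.2 ⟨h1, h2⟩⟩
          have hxe : x = u := by omega
          subst hxe
          exact ⟨h2, h1⟩
        · rintro ⟨h1, h2⟩
          exact ⟨h2, u, hu, h1⟩
      rw [this, hl.inter_card u hvn] at hun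
      rw [add_mul, mul_add]
      omega
    · push Not at hadj
      rw [runs_insert_gap S v (fun x hx => by
        have h1 := hadj x hx
        have h2 := hmax x hx
        omega)]
      have : E v ∩ S.biUnion E = ∅ := by
        rw [Finset.eq_empty_iff_forall_notMem]
        intro w hw
        simp only [Finset.mem_inter, Finset.mem_biUnion] at hw
        obtain ⟨h1, x, hx, h2⟩ := hw
        have hxu := hmax x hx
        have hxa := hadj x hx
        have := (hl.inter_nonempty_iff v hvn x (by omega) (by omega)).1
            ⟨w, Finset.mem_inter.2 ⟨h1, h2⟩⟩
        omega
      rw [this, Finset.card_empty] at hun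
      rw [add_mul, mul_add, mul_add]
      omega

theorem card_filter_powersetCard_succ (p : Finset ℕ → Prop) [DecidablePred p] (n i : ℕ) :
    (((Finset.range (n + 1)).powersetCard (i + 1)).filter p).card =
      (((Finset.range n).powersetCard (i + 1)).filter p).card +
        (((Finset.range n).powersetCard i).filter (fun S => p (insert n S))).card := by
  rw [Finset.range_add_one, Finset.powersetCard_succ_insert (by simp), Finset.filter_union,
    Finset.card_union_of_disjoint, Finset.filter_image, Finset.card_image_of_injOn]
  · intro S hS T hT hST
    simp only [Finset.coe_filter, Finset.mem_powersetCard, Set.mem_ofPred_eq] at hS hT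
    have h1 : n ∉ S := fun hc => by simpa using hS.1.1 hc
    have h2 : n ∉ T := fun hc => by simpa using hT.1.1 hc
    rw [← Finset.erase_insert h1, hST, Finset.erase_insert h2]
  · rw [Finset.disjoint_left]
    intro S hS hS2
    simp only [Finset.mem_filter, Finset.mem_powersetCard, Finset.mem_image] at hS hS2
    obtain ⟨⟨T, -, rfl⟩, -⟩ := hS2
    have := hS.1.1 (Finset.mem_insert_self n T)
    simp at this

theorem count_runs (n : ℕ) :
    (∀ i r, (((Finset.range n).powersetCard (i + 1)).filter (fun S => runs S = r + 1)).card =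
      i.choose r * (n - i).choose (r + 1)) ∧
    (∀ i r, i ≤ n → (((Finset.range n).powersetCard i).filter
      (fun S => runs (insert n S) = r + 1)).card = i.choose r * (n - i).choose r) := by
  induction n with
  | zero =>
    constructor
    · intro i r
      simp
    · intro i r hi
      obtain rfl : i = 0 := by omega
      rcases r with _ | r
      · simp [Finset.filter_singleton, runs]
      · simp [Finset.filter_singleton, runs]
  | succ n ih =>
    obtain ⟨ha, hb⟩ := ih
    constructor
    · intro i r
      rw [card_filter_powersetCard_succ, ha]
      by_cases hi : i ≤ n
      · rw [hb i r hi, Nat.succ_sub hi, Nat.choose_succ_succ (n - i) r]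
        ring
      · have h1 : (Finset.range n).powersetCard i = ∅ :=
          Finset.powersetCard_eq_empty.2 (by simp; omega)
        have h2 : n + 1 - i = 0 := by omega
        have h3 : n - i = 0 := by omega
        rw [h1, h2, h3]; simp
    · intro i r hi
      rcases i with _ | i
      · rcases r with _ | r
        · simp [Finset.filter_singleton, runs]
        · simp [Finset.filter_singleton, runs]
      · rw [card_filter_powersetCard_succ]
        have hi' : i ≤ n := by omega
        have e1 : ((Finset.range n).powersetCard (i + 1)).filter
            (fun S => runs (insert (n + 1) S) = r + 1) =
            ((Finset.range n).powersetCard (i + 1)).filter (fun S => runs S = r) := by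
          refine Finset.filter_congr fun S hS => ?_
          rw [runs_insert_gap]
          · omega
          · intro x hx
            have := (Finset.mem_powersetCard.1 hS).1 hx
            simp only [Finset.mem_range] at this
            omega
        have e2 : ((Finset.range n).powersetCard i).filter
            (fun S => runs (insert (n + 1) (insert n S)) = r + 1) =
            ((Finset.range n).powersetCard i).filter
              (fun S => runs (insert n S) = r + 1) := by
          refine Finset.filter_congr fun S hS => ?_
          rw [runs_insert_adj]
          · intro x hx
            rcases Finset.mem_insert.1 hx with rfl | hx
            · omega
            · have := (Finset.mem_powersetCard.1 hS).1 hx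
              simp only [Finset.mem_range] at this
              omega
          · exact Finset.mem_insert_self _ _
        rw [e1, e2, hb i r hi', Nat.add_sub_add_right]
        rcases r with _ | r
        · have : ((Finset.range n).powersetCard (i + 1)).filter (fun S => runs S = 0) = ∅ := by
            rw [Finset.filter_eq_empty_iff]
            intro S hS h0
            have := runs_pos S (Finset.card_pos.1 (by
              rw [(Finset.mem_powersetCard.1 hS).2]; omega))
            omega
          rw [this]; simp
        · rw [ha, Nat.choose_succ_succ i r]
          ring

theorem β_eq_count {k V : Type} [Field k] [Fintype V] [DecidableEq V]
    {n d α : ℕ} {E : ℕ → Finset V} (hd : 2 * α < d) (hline : IsLineHypergraph n d α E)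
    (F : MinimalGradedFreeResolution k V (edgeIdeal k (fun l : Fin n => E l.val))) (i j : ℕ) :
    F.β i j = (((Finset.range n).powersetCard i).filter
      (fun S => (S.biUnion E).card = j)).card := by
  classical
  have hp : ∀ (v : Fin n) (T : Finset (Fin n)), v ∉ T →
      (E v.val \ unionE (fun l : Fin n => E l.val) T).Nonempty := by
    intro v T hv
    have hsub : E v.val ∩ unionE (fun l : Fin n => E l.val) T ⊆
        (if v.val + 1 < n then E v.val ∩ E (v.val + 1) else ∅) ∪
        (if 1 ≤ v.val then E (v.val - 1) ∩ E (v.val - 1 + 1) else ∅) := by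
      intro w hw
      simp only [unionE, Finset.mem_inter, Finset.mem_biUnion] at hw
      obtain ⟨h1, u, hu, h2⟩ := hw
      have hne : v.val ≠ u.val := fun hc => hv (Fin.ext hc ▸ hu)
      rcases (hline.inter_nonempty_iff v.val v.2 u.val u.2 hne).1
        ⟨w, Finset.mem_inter.2 ⟨h1, h2⟩⟩ with h | h
      · rw [Finset.mem_union]
        left
        rw [if_pos (h ▸ u.2), ← h]
        exact Finset.mem_inter.2 ⟨h1, h2⟩
      · rw [Finset.mem_union]
        right
        rw [if_pos (by omega), h, Nat.add_sub_cancel, ← h]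
        exact Finset.mem_inter.2 ⟨h2, h1⟩
    have hc1 : (if v.val + 1 < n then E v.val ∩ E (v.val + 1) else ∅).card ≤ α := by
      split_ifs with h
      · exact (hline.inter_card _ h).le
      · simp
    have hc2 : (if 1 ≤ v.val then E (v.val - 1) ∩ E (v.val - 1 + 1) else ∅).card ≤ α := by
      split_ifs with h
      · exact (hline.inter_card _ (by have := v.2; omega)).le
      · simp
    have hle := (Finset.card_le_card hsub).trans (Finset.card_union_le _ _)
    have hv' := hline.card_eq v.val v.2
    have := Finset.card_sdiff_add_card_inter (E v.val) (unionE (fun l : Fin n => E l.val) T)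
    apply Finset.card_pos.1
    omega
  let Y := taylorRes k V (fun l : Fin n => E l.val) hp
  let : Fintype {a : Y.ι i // Y.deg i a = j} :=
    inferInstanceAs (Fintype {a : {S : Finset (Fin n) // S.card = i} //
      (unionE (fun l : Fin n => E l.val) a.1).card = j})
  rw [F.β_eq Y i j, ← Finset.card_univ]
  refine Finset.card_bij (fun a _ => a.1.1.map Fin.valEmbedding) ?_ ?_ ?_
  · rintro ⟨⟨S, hS⟩, hj⟩ -
    change (unionE (fun l : Fin n => E l.val) S).card = j at hj
    simp only [Finset.mem_filter, Finset.mem_powersetCard, Finset.card_map]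
    refine ⟨⟨?_, hS⟩, ?_⟩
    · intro x hx
      obtain ⟨y, -, rfl⟩ := Finset.mem_map.1 hx
      simp
    · rw [← hj, unionE, Finset.map_eq_image, Finset.image_biUnion]
      rfl
  · rintro ⟨⟨S, hS⟩, hj⟩ - ⟨⟨T, hT⟩, hj'⟩ - h
    have := Finset.map_injective _ h
    simp only at this
    subst this
    rfl
  · intro S hS
    simp only [Finset.mem_filter, Finset.mem_powersetCard] at hS
    have hlt : ∀ m ∈ S, m < n := fun m hm => by simpa using hS.1.1 hm
    have hmap : (S.attachFin hlt).map Fin.valEmbedding = S := Finset.map_valEmbedding_attachFin hlt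
    refine ⟨⟨⟨S.attachFin hlt, ?_⟩, ?_⟩, Finset.mem_univ _, hmap⟩
    · rw [Finset.card_attachFin]; exact hS.1.2
    · change (unionE (fun l : Fin n => E l.val) (S.attachFin hlt)).card = j
      rw [← hS.2]
      conv_rhs => rw [← hmap]
      rw [unionE, Finset.map_eq_image, Finset.image_biUnion]
      rfl

/-- Let `L_n^{d,α}` be a line hypergraph with `d > 2α` and let
`1 ≤ i < n`.  Then for every `r` with `1 ≤ r ≤ i`,
`β_{i, i·d - α·(i-r)}(R ⧸ I(L_n^{d,α})) = C(i-1, r-1) · C(n-i+1, r)`,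
and `β_{i,j} = 0` for every `j` not of the form `i·d - α·(i-r)` with `1 ≤ r ≤ i`. -/
theorem gradedBetti_line (k V : Type) [Field k] [Fintype V] [DecidableEq V]
    (n d α i : ℕ) (E : ℕ → Finset V)
    (hd : 2 * α < d) (hi : 1 ≤ i) (hin : i < n)
    (hline : IsLineHypergraph n d α E)
    (F : MinimalGradedFreeResolution k V (edgeIdeal k (fun l : Fin n => E l.val))) :
    (∀ r, 1 ≤ r → r ≤ i →
        F.β i (i * d - α * (i - r)) = (i - 1).choose (r - 1) * (n - i + 1).choose r) ∧
      (∀ j, (∀ r, 1 ≤ r → r ≤ i → j ≠ i * d - α * (i - r)) → F.β i j = 0) := by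
  have hα : 0 < α := by
    rw [← hline.inter_card 0 (by omega), Finset.card_pos,
      hline.inter_nonempty_iff 0 (by omega) 1 (by omega) (by omega)]
    exact Or.inl rfl
  have hαi : α * i ≤ i * d := by
    rw [mul_comm]
    exact Nat.mul_le_mul_left i (by omega)
  have key : ∀ S ∈ (Finset.range n).powersetCard i,
      1 ≤ runs S ∧ runs S ≤ i ∧ (S.biUnion E).card = i * d - α * (i - runs S) := by
    intro S hS
    rw [Finset.mem_powersetCard] at hS
    have h1 := card_biUnion_line hline S (fun x hx => by simpa using hS.1 hx)
    have h2 := runs_le S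
    rw [hS.2] at h1 h2
    refine ⟨runs_pos S (Finset.card_pos.1 (by omega)), h2, ?_⟩
    have h3 : α * runs S ≤ α * i := Nat.mul_le_mul_left α h2
    rw [Nat.mul_sub]
    omega
  constructor
  · intro r hr1 hri
    rw [β_eq_count hd hline F]
    have hfil : ((Finset.range n).powersetCard i).filter
        (fun S => (S.biUnion E).card = i * d - α * (i - r)) =
        ((Finset.range n).powersetCard i).filter (fun S => runs S = r) := by
      refine Finset.filter_congr fun S hS => ?_
      obtain ⟨h1, h2, h3⟩ := key S hS
      rw [h3]
      constructor
      · intro h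
        have e1 : α * (i - runs S) ≤ α * i := Nat.mul_le_mul_left α (by omega)
        have e2 : α * (i - r) ≤ α * i := Nat.mul_le_mul_left α (by omega)
        have e3 : α * (i - runs S) = α * (i - r) := by omega
        have e4 := Nat.eq_of_mul_eq_mul_left hα e3
        omega
      · intro h
        rw [h]
    rw [hfil]
    obtain ⟨i, rfl⟩ : ∃ l, i = l + 1 := ⟨i - 1, by omega⟩
    obtain ⟨r, rfl⟩ : ∃ l, r = l + 1 := ⟨r - 1, by omega⟩
    rw [(count_runs n).1 i r]
    have : n - (i + 1) + 1 = n - i := by omega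
    rw [this]
    simp
  · intro j hj
    rw [β_eq_count hd hline F, Finset.card_eq_zero, Finset.filter_eq_empty_iff]
    intro S hS h
    obtain ⟨h1, h2, h3⟩ := key S hS
    exact hj (runs S) h1 h2 (h ▸ h3)
end
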